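/- arXiv:1610.09925 — 8 statements merged into one kernel-verified Lean document; each statement's English description precedes it below -/
import Mathlib

section
/- Let X be a complex Banach space, D(A) ⊆ X a dense linear subspace, and A : D(A) → X a linear map whose graph is closed in X × X. Assume there is a linear subspace D ⊆ D(A), dense in X, such that: (a) every u₀ ∈ D admits exactly one classical solution of the Cauchy problem u' = Au, u(0) = u₀; and (b) for every T > 0 there is a constant C_T > 0 such that for every u₀ ∈ D the classical solution u with u(0) = u₀ satisfies ‖u(t)‖ ≤ C_T‖u₀‖ for all t ∈ [0,T]. Then for every u₀ ∈ X there exists exactly one mild solution of the Cauchy problem with initial value u₀. -/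
open MeasureTheory

noncomputable section

variable {X : Type*} [NormedAddCommGroup X] [NormedSpace ℂ X]

/-- `u` is a classical solution of `u' = A u`, `u(0) = u₀`, for the (unbounded) operator `A`
with domain the subspace `D`: `u` is continuously differentiable on `[0,∞)`, takes values in
`D`, and its derivative is `A (u t)` there. -/
def IsClassicalSolution (D : Submodule ℂ X) (A : D →ₗ[ℂ] X) (u₀ : X) (u : ℝ → X) : Prop :=
  u 0 = u₀ ∧
    ∃ v : ℝ → X,
      (∀ t : ℝ, 0 ≤ t → ∃ h : u t ∈ D, A ⟨u t, h⟩ = v t) ∧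
      (∀ t : ℝ, 0 ≤ t → HasDerivWithinAt u (v t) (Set.Ici 0) t) ∧
      ContinuousOn u (Set.Ici 0) ∧ ContinuousOn v (Set.Ici 0)

/-- `u` is a mild solution of `u' = A u`, `u(0) = u₀`: `u` is continuous on `[0,∞)`,
`∫₀ᵗ u(s) ds ∈ D` and `A (∫₀ᵗ u(s) ds) = u t - u₀` for all `t ≥ 0`. -/
def IsMildSolution (D : Submodule ℂ X) (A : D →ₗ[ℂ] X) (u₀ : X) (u : ℝ → X) : Prop :=
  ContinuousOn u (Set.Ici 0) ∧
    ∀ t : ℝ, 0 ≤ t →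
      ∃ h : (∫ s in (0:ℝ)..t, u s) ∈ D, A ⟨∫ s in (0:ℝ)..t, u s, h⟩ = u t - u₀

open Filter Topology

/-- The graph of a partially defined linear operator, as a subspace of `X × X`. -/
def operatorGraph (D : Submodule ℂ X) (A : D →ₗ[ℂ] X) : Submodule ℂ (X × X) where
  carrier := {p | ∃ h : p.1 ∈ D, A ⟨p.1, h⟩ = p.2}
  zero_mem' := ⟨D.zero_mem, A.map_zero⟩
  add_mem' := by
    rintro p q ⟨hp, hpA⟩ ⟨hq, hqA⟩
    refine ⟨D.add_mem hp hq, ?_⟩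
    rw [Prod.snd_add, ← hpA, ← hqA, ← map_add]
    rfl
  smul_mem' := by
    rintro c p ⟨hp, hpA⟩
    refine ⟨D.smul_mem c hp, ?_⟩
    rw [Prod.smul_snd, ← hpA, ← map_smul]
    rfl

lemma mem_operatorGraph {D : Submodule ℂ X} {A : D →ₗ[ℂ] X} {p : X × X} :
    p ∈ operatorGraph D A ↔ ∃ h : p.1 ∈ D, A ⟨p.1, h⟩ = p.2 := Iff.rfl

lemma continuous_comp_max_zero {E : Type*} [TopologicalSpace E] {u : ℝ → E}
    (hu : ContinuousOn u (Set.Ici 0)) :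
    Continuous fun t => u (max t 0) :=
  hu.comp_continuous (by fun_prop) fun t => le_max_right t 0

lemma intervalIntegral_comp_max_zero (u : ℝ → X) {t : ℝ} (ht : 0 ≤ t) :
    ∫ s in (0:ℝ)..t, u (max s 0) = ∫ s in (0:ℝ)..t, u s := by
  refine intervalIntegral.integral_congr fun s hs => ?_
  rw [Set.uIcc_of_le ht] at hs
  simp only [max_eq_left hs.1]

lemma ContinuousOn.intervalIntegrable_of_Ici {E : Type*} [NormedAddCommGroup E] {u : ℝ → E}
    (hu : ContinuousOn u (Set.Ici 0)) {t : ℝ} (ht : 0 ≤ t) : IntervalIntegrable u volume 0 t :=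
  (hu.mono (by rw [Set.uIcc_of_le ht]; exact Set.Icc_subset_Ici_self)).intervalIntegrable

/-- Integrating a continuous curve in a closed subspace of `X × X` stays in the subspace. -/
lemma intervalIntegral_prodMk_mem [CompleteSpace X] {G : Submodule ℂ (X × X)}
    (hG : IsClosed (G : Set (X × X))) {u v : ℝ → X} (hu : Continuous u) (hv : Continuous v)
    (hmem : ∀ t, (u t, v t) ∈ G) (t : ℝ) :
    (∫ s in (0:ℝ)..t, u s, ∫ s in (0:ℝ)..t, v s) ∈ G := by
  have : CompleteSpace G := hG.completeSpace_coe
  let f : ℝ → G := fun s => ⟨(u s, v s), hmem s⟩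
  have hf : Continuous f := (hu.prodMk hv).subtype_mk _
  have hint : IntervalIntegrable f volume 0 t := hf.intervalIntegrable 0 t
  have h1 := ((ContinuousLinearMap.fst ℂ X X).comp G.subtypeL).intervalIntegral_comp_comm hint
  have h2 := ((ContinuousLinearMap.snd ℂ X X).comp G.subtypeL).intervalIntegral_comp_comm hint
  have h : (∫ s in (0:ℝ)..t, u s, ∫ s in (0:ℝ)..t, v s)
      = ((∫ s in (0:ℝ)..t, f s : G) : X × X) := Prod.ext h1 h2
  rw [h]
  exact SetLike.coe_mem _

namespace IsClassicalSolution

variable {D : Submodule ℂ X} {A : D →ₗ[ℂ] X} {x y : X} {u w : ℝ → X}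

lemma sub (hu : IsClassicalSolution D A x u) (hw : IsClassicalSolution D A y w) :
    IsClassicalSolution D A (x - y) (u - w) := by
  obtain ⟨hu0, u', huA, hud, huc, huc'⟩ := hu
  obtain ⟨hw0, w', hwA, hwd, hwc, hwc'⟩ := hw
  exact ⟨by simp [hu0, hw0], u' - w',
    fun t ht => (operatorGraph D A).sub_mem (x := (u t, u' t)) (y := (w t, w' t))
      (huA t ht) (hwA t ht),
    fun t ht => (hud t ht).sub (hwd t ht), huc.sub hwc, huc'.sub hwc'⟩

/-- For a closed operator, classical solutions are mild solutions. -/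
lemma isMildSolution [CompleteSpace X]
    (hclosed : IsClosed (operatorGraph D A : Set (X × X))) (hu : IsClassicalSolution D A x u) :
    IsMildSolution D A x u := by
  obtain ⟨hu0, v, huA, hud, huc, hvc⟩ := hu
  refine ⟨huc, fun t ht => ?_⟩
  have hmem := intervalIntegral_prodMk_mem hclosed (continuous_comp_max_zero huc)
    (continuous_comp_max_zero hvc) (fun s => huA _ (le_max_right s 0)) t
  have hftc : ∫ s in (0:ℝ)..t, v s = u t - u 0 :=
    intervalIntegral.integral_eq_sub_of_hasDeriv_right_of_le ht
      (huc.mono Set.Icc_subset_Ici_self)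
      (fun s hs => (hud s hs.1.le).mono fun r hr => hs.1.le.trans (le_of_lt hr))
      (hvc.intervalIntegrable_of_Ici ht)
  rw [intervalIntegral_comp_max_zero u ht, intervalIntegral_comp_max_zero v ht, hftc, hu0] at hmem
  exact hmem

end IsClassicalSolution

namespace IsMildSolution

variable {D : Submodule ℂ X} {A : D →ₗ[ℂ] X} {x y : X} {u w : ℝ → X}

lemma integral_mem_operatorGraph (hu : IsMildSolution D A x u) {t : ℝ} (ht : 0 ≤ t) :
    (∫ s in (0:ℝ)..t, u s, u t - x) ∈ operatorGraph D A :=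
  hu.2 t ht

lemma sub (hu : IsMildSolution D A x u) (hw : IsMildSolution D A y w) :
    IsMildSolution D A (x - y) (u - w) := by
  refine ⟨hu.1.sub hw.1, fun t ht => ?_⟩
  have h := (operatorGraph D A).sub_mem (hu.integral_mem_operatorGraph ht)
    (hw.integral_mem_operatorGraph ht)
  rw [Prod.mk_sub_mk, ← intervalIntegral.integral_sub (hu.1.intervalIntegrable_of_Ici ht)
    (hw.1.intervalIntegrable_of_Ici ht), sub_sub_sub_comm] at h
  exact h

/-- The primitive of a mild solution starting at `0` is a classical solution. -/
lemma isClassicalSolution_integral [CompleteSpace X] (hu : IsMildSolution D A 0 u) :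
    IsClassicalSolution D A 0 (fun t => ∫ s in (0:ℝ)..t, u (max s 0)) := by
  have hc := continuous_comp_max_zero hu.1
  have hd : ∀ t, HasDerivAt (fun t => ∫ s in (0:ℝ)..t, u (max s 0)) (u (max t 0)) t :=
    fun t => hc.integral_hasStrictDerivAt 0 t |>.hasDerivAt
  refine ⟨intervalIntegral.integral_same, fun t => u (max t 0), fun t ht => ?_,
    fun t _ => (hd t).hasDerivWithinAt, fun t _ => (hd t).continuousAt.continuousWithinAt,
    hc.continuousOn⟩
  have h := hu.integral_mem_operatorGraph ht
  rw [← intervalIntegral_comp_max_zero u ht, sub_zero, ← max_eq_left ht] at h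
  simpa only [max_eq_left ht] using mem_operatorGraph.1 h

/-- If the zero function is the only classical solution starting at `0`, then it is the only mild
solution starting at `0`. -/
lemma eq_zero [CompleteSpace X]
    (huniq : ∀ v, IsClassicalSolution D A 0 v → ∀ t : ℝ, 0 ≤ t → v t = 0)
    (hu : IsMildSolution D A 0 u) {t : ℝ} (ht : 0 ≤ t) : u t = 0 := by
  have h0 : ((0 : X), u t - 0) ∈ operatorGraph D A := by
    have h := hu.integral_mem_operatorGraph ht
    have hW := huniq _ hu.isClassicalSolution_integral t ht
    rw [← intervalIntegral_comp_max_zero u ht] at h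
    rwa [hW] at h
  obtain ⟨h, hA⟩ := h0
  rw [sub_zero] at hA
  exact hA.symm.trans A.map_zero

/-- Locally uniform limits of mild solutions of a closed operator are mild solutions. -/
lemma of_tendsto [CompleteSpace X]
    (hclosed : IsClosed (operatorGraph D A : Set (X × X))) {x : ℕ → X} {F : ℕ → ℝ → X}
    (hF : ∀ n, IsMildSolution D A (x n) (F n)) (hx : Tendsto x atTop (𝓝 y))
    (hlim : ∀ T > (0:ℝ), TendstoUniformlyOn F w atTop (Set.Icc 0 T)) :
    IsMildSolution D A y w := by
  have hwc : ContinuousOn w (Set.Ici 0) := by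
    intro t ht
    have ht' : (0:ℝ) ≤ t := ht
    have hT : ContinuousOn w (Set.Icc 0 (t + 1)) :=
      (hlim (t + 1) (by linarith)).continuousOn
        (Frequently.of_forall fun n => (hF n).1.mono Set.Icc_subset_Ici_self)
    refine (hT t ⟨ht', by linarith⟩).mono_of_mem_nhdsWithin ?_
    filter_upwards [self_mem_nhdsWithin, mem_nhdsWithin_of_mem_nhds (Iio_mem_nhds (lt_add_one t))]
      with s hs hs' using ⟨hs, le_of_lt hs'⟩
  refine ⟨hwc, fun t ht => ?_⟩
  have hunif := hlim (t + 1) (by linarith)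
  have hint : Tendsto (fun n => ∫ s in (0:ℝ)..t, F n s) atTop (𝓝 (∫ s in (0:ℝ)..t, w s)) := by
    rw [Metric.tendsto_atTop']
    intro ε hε
    obtain ⟨N, hN⟩ := eventually_atTop.1
      (Metric.tendstoUniformlyOn_iff.1 hunif (ε / (t + 1)) (by positivity))
    refine ⟨N, fun n hn => ?_⟩
    rw [dist_eq_norm, ← intervalIntegral.integral_sub ((hF n).1.intervalIntegrable_of_Ici ht)
      (hwc.intervalIntegrable_of_Ici ht)]
    calc ‖∫ s in (0:ℝ)..t, F n s - w s‖ ≤ ε / (t + 1) * |t - 0| := by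
          refine intervalIntegral.norm_integral_le_of_norm_le_const fun s hs => ?_
          rw [Set.uIoc_of_le ht] at hs
          rw [← dist_eq_norm, dist_comm]
          exact (hN n hn.le s ⟨hs.1.le, by linarith [hs.2]⟩).le
      _ < ε := by
          rw [sub_zero, abs_of_nonneg ht, div_mul_eq_mul_div, div_lt_iff₀ (by linarith)]
          nlinarith
  have hpt : Tendsto (fun n => F n t) atTop (𝓝 (w t)) :=
    hunif.tendsto_at ⟨ht, by linarith⟩
  exact hclosed.mem_of_tendsto (hint.prodMk_nhds (hpt.sub hx))
    (Eventually.of_forall fun n => (hF n).2 t ht)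

end IsMildSolution

/-- Theorem 2.5, (iii) ⟹ (ii). Let `A` be a densely defined closed operator
on a complex Banach space `X`. If there is a dense subspace `D₀ ⊆ D(A)` such that every
`u₀ ∈ D₀` has a unique classical solution, and solutions starting in `D₀` satisfy a uniform
bound `‖u(t)‖ ≤ C_T ‖u₀‖` on `[0,T]`, then every `u₀ ∈ X` has exactly one mild solution. -/
theorem exists_unique_mild_solution
    [CompleteSpace X]
    (D : Submodule ℂ X) (hdense : Dense (D : Set X)) (A : D →ₗ[ℂ] X)
    (hclosed : IsClosed {p : X × X | ∃ h : p.1 ∈ D, A ⟨p.1, h⟩ = p.2})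
    (D₀ : Submodule ℂ X) (hsub : (D₀ : Set X) ⊆ (D : Set X)) (hdense₀ : Dense (D₀ : Set X))
    (hexist : ∀ u₀ ∈ D₀, ∃ u : ℝ → X, IsClassicalSolution D A u₀ u ∧
      ∀ v : ℝ → X, IsClassicalSolution D A u₀ v → ∀ t : ℝ, 0 ≤ t → v t = u t)
    (hbound : ∀ T > (0:ℝ), ∃ C > (0:ℝ), ∀ u₀ ∈ D₀, ∀ u : ℝ → X,
      IsClassicalSolution D A u₀ u → ∀ t ∈ Set.Icc (0:ℝ) T, ‖u t‖ ≤ C * ‖u₀‖) :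
    ∀ u₀ : X, ∃ u : ℝ → X, IsMildSolution D A u₀ u ∧
      ∀ v : ℝ → X, IsMildSolution D A u₀ v → ∀ t : ℝ, 0 ≤ t → v t = u t := by
  intro u₀
  have huniq : ∀ v, IsClassicalSolution D A 0 v → ∀ t : ℝ, 0 ≤ t → v t = 0 := by
    intro v hv t ht
    obtain ⟨C, -, hC⟩ := hbound (t + 1) (by linarith)
    simpa using hC 0 D₀.zero_mem v hv t ⟨ht, by linarith⟩
  obtain ⟨x, hxD, hx⟩ := mem_closure_iff_seq_limit.1 (hdense₀ u₀)
  choose F hF _ using fun n => hexist (x n) (hxD n)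
  have hcauchy : ∀ T > (0:ℝ), UniformCauchySeqOn F atTop (Set.Icc 0 T) := by
    intro T hT
    obtain ⟨C, hC0, hC⟩ := hbound T hT
    rw [Metric.uniformCauchySeqOn_iff]
    intro ε hε
    obtain ⟨N, hN⟩ := Metric.cauchySeq_iff.1 hx.cauchySeq (ε / C) (by positivity)
    refine ⟨N, fun m hm n hn t ht => ?_⟩
    have h := hN m hm n hn
    rw [dist_eq_norm, lt_div_iff₀' hC0] at h
    rw [dist_eq_norm]
    exact (hC _ (D₀.sub_mem (hxD m) (hxD n)) _ ((hF m).sub (hF n)) t ht).trans_lt h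
  have hpt : ∀ t : ℝ, ∃ y, 0 ≤ t → Tendsto (fun n => F n t) atTop (𝓝 y) := by
    intro t
    by_cases ht : 0 ≤ t
    · obtain ⟨y, hy⟩ := cauchySeq_tendsto_of_complete
        ((hcauchy (t + 1) (by linarith)).cauchySeq ⟨ht, by linarith⟩)
      exact ⟨y, fun _ => hy⟩
    · exact ⟨0, fun h => absurd h ht⟩
  choose u hu using hpt
  have hmild : IsMildSolution D A u₀ u :=
    IsMildSolution.of_tendsto hclosed (fun n => (hF n).isMildSolution hclosed) hx fun T hT =>
      (hcauchy T hT).tendstoUniformlyOn_of_tendsto fun t ht => hu t ht.1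
  refine ⟨u, hmild, fun v hv t ht => ?_⟩
  have hsub₀ : IsMildSolution D A 0 (v - u) := by simpa using hv.sub hmild
  exact sub_eq_zero.1 (hsub₀.eq_zero huniq ht)

end
end

section
/- Let U ⊆ ℝⁿ be open and nonempty, and let a : U → ℂ^{N×N} be smooth (infinitely differentiable on U). Then there exists a nonempty open set Ũ ⊆ U and smooth functions λ₁, …, λ_N : Ũ → ℂ such that for every ξ ∈ Ũ the characteristic polynomial of a(ξ) factors as det(λ·I_N − a(ξ)) = ∏_{j=1}^N (λ − λ_j(ξ)) for all λ ∈ ℂ; in particular λ₁(ξ), …, λ_N(ξ) are the eigenvalues of a(ξ) counted with algebraic multiplicity. -/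
open Matrix Complex

section ImplicitFunction

open scoped Topology ContDiff

variable {E F G : Type*} [NormedAddCommGroup E] [NormedSpace ℝ E] [CompleteSpace E]
  [NormedAddCommGroup F] [NormedSpace ℝ F] [CompleteSpace F]
  [NormedAddCommGroup G] [NormedSpace ℝ G] [CompleteSpace G]

/-- The implicit function theorem for smooth maps, producing an implicit function that is smooth
on a whole neighbourhood of the base point. -/
theorem ContDiffOn.exists_contDiffOn_implicitFunction {f : E × F → G} {W : Set (E × F)}
    (hW : IsOpen W) (hf : ContDiffOn ℝ ∞ f W)
    (hinv : ∀ v ∈ W, (fderiv ℝ f v ∘L .inr ℝ E F).IsInvertible) {u : E × F} (hu : u ∈ W) :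
    ∃ V : Set E, IsOpen V ∧ u.1 ∈ V ∧ ∃ ψ : E → F, ContDiffOn ℝ ∞ ψ V ∧
      ∀ x ∈ V, (x, ψ x) ∈ W ∧ f (x, ψ x) = f u := by
  have hfat : ∀ v ∈ W, ContDiffAt ℝ ∞ f v := fun v hv => hf.contDiffAt (hW.mem_nhds hv)
  have hne : (∞ : WithTop ℕ∞) ≠ 0 := by simp
  set ψ := (hfat u hu).implicitFunction hne (hinv u hu) with hψ
  have hψu : ψ u.1 = u.2 := (hfat u hu).implicitFunction_apply_self hne (hinv u hu)
  have hψ1 : ContDiffAt ℝ 1 ψ u.1 :=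
    ((hfat u hu).contDiffAt_implicitFunction hne (hinv u hu)).of_le (by exact_mod_cast le_top)
  have hcont : ∀ᶠ x in 𝓝 u.1, ContinuousAt ψ x :=
    (hψ1.eventually (by simp)).mono fun x hx => hx.continuousAt
  have hmem : ∀ᶠ x in 𝓝 u.1, (x, ψ x) ∈ W := by
    have : ContinuousAt (fun x => (x, ψ x)) u.1 := continuousAt_id.prodMk hψ1.continuousAt
    exact this.eventually_mem (hW.mem_nhds (by simpa [hψu] using hu))
  have heq := (hfat u hu).eventually_apply_implicitFunction hne (hinv u hu)
  obtain ⟨V, hV, hVo, huV⟩ := eventually_nhds_iff.1 (hcont.and (hmem.and heq))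
  refine ⟨V, hVo, huV, ψ, fun x hx => ContDiffAt.contDiffWithinAt ?_, fun x hx => (hV x hx).2⟩
  obtain ⟨hcx, hWx, hex⟩ := hV x hx
  refine ((hfat _ hWx).contDiffAt_implicitFunction hne (hinv _ hWx)).congr_of_eventuallyEq ?_
  have hgraph : ContinuousAt (fun y => (y, ψ y)) x := continuousAt_id.prodMk hcx
  filter_upwards [hgraph.eventually
    ((hfat _ hWx).eventually_apply_eq_iff_implicitFunction hne (hinv _ hWx)),
    hVo.mem_nhds hx] with y hy hyV
  exact (hy.1 ((hV y hyV).2.2.trans hex.symm)).symm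

end ImplicitFunction

section VanishingProduct

/-- If a finite product of continuous functions vanishes on a nonempty open set, then one of the
factors vanishes on a nonempty open subset. -/
theorem exists_isOpen_eqOn_zero_of_prod_eq_zero {X ι R : Type*} [TopologicalSpace X]
    [CommMonoidWithZero R] [Nontrivial R] [TopologicalSpace R] [T1Space R]
    (s : Finset ι) (f : ι → X → R) {V : Set X} (hV : IsOpen V) (hne : V.Nonempty)
    (hf : ∀ i ∈ s, ContinuousOn (f i) V) (h : ∀ x ∈ V, ∃ i ∈ s, f i x = 0) :
    ∃ i ∈ s, ∃ W : Set X, IsOpen W ∧ W.Nonempty ∧ W ⊆ V ∧ ∀ x ∈ W, f i x = 0 := by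
  classical
  induction s using Finset.induction_on generalizing V with
  | empty => obtain ⟨x, hx⟩ := hne; simpa using h x hx
  | insert i s _ ih =>
    by_cases hi : ∀ x ∈ V, f i x = 0
    · exact ⟨i, by simp, V, hV, hne, subset_rfl, hi⟩
    · push Not at hi
      obtain ⟨x, hxV, hx⟩ := hi
      obtain ⟨j, hj, W, hW, hWne, hWV, hW0⟩ := ih
        ((hf i (by simp)).isOpen_inter_preimage hV isOpen_compl_singleton) ⟨x, hxV, hx⟩
        (fun j hj => (hf j (by simp [hj])).mono Set.inter_subset_left)
        (fun y hy => by
          obtain ⟨j, hj, hj0⟩ := h y hy.1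
          rcases Finset.mem_insert.1 hj with rfl | hj
          · exact absurd hj0 hy.2
          · exact ⟨j, hj, hj0⟩)
      exact ⟨j, by simp [hj], W, hW, hWne, hWV.trans Set.inter_subset_left, hW0⟩

end VanishingProduct

section PolynomialFamily

open Polynomial
open scoped ContDiff

variable {E : Type*} [NormedAddCommGroup E] [NormedSpace ℝ E]

/-- A family of complex polynomials all of whose coefficients depend smoothly on the parameter. -/
def SmoothCoeffOn (p : E → ℂ[X]) (U : Set E) : Prop :=
  ∀ k, ContDiffOn ℝ ∞ (fun x => (p x).coeff k) U

namespace SmoothCoeffOn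

variable {p q : E → ℂ[X]} {U V : Set E}

theorem mono (hp : SmoothCoeffOn p U) (h : V ⊆ U) : SmoothCoeffOn p V := fun k => (hp k).mono h

theorem const (P : ℂ[X]) : SmoothCoeffOn (fun _ : E => P) U := fun _ => contDiffOn_const

theorem C {c : E → ℂ} (hc : ContDiffOn ℝ ∞ c U) :
    SmoothCoeffOn (fun x => Polynomial.C (c x)) U := by
  intro k
  by_cases hk : k = 0
  · simpa [hk] using hc
  · simpa [coeff_C, hk] using contDiffOn_const

theorem sub (hp : SmoothCoeffOn p U) (hq : SmoothCoeffOn q U) :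
    SmoothCoeffOn (fun x => p x - q x) U := fun k => by
  simpa using (hp k).sub (hq k)

theorem mul (hp : SmoothCoeffOn p U) (hq : SmoothCoeffOn q U) :
    SmoothCoeffOn (fun x => p x * q x) U := fun k => by
  simp only [coeff_mul]
  exact ContDiffOn.sum fun i _ => (hp _).mul (hq _)

theorem sum {ι : Type*} {s : Finset ι} {p : ι → E → ℂ[X]}
    (h : ∀ i ∈ s, SmoothCoeffOn (p i) U) : SmoothCoeffOn (fun x => ∑ i ∈ s, p i x) U := fun k => by
  simp only [finsetSum_coeff]
  exact ContDiffOn.sum fun i hi => h i hi k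

theorem prod {ι : Type*} {s : Finset ι} {p : ι → E → ℂ[X]}
    (h : ∀ i ∈ s, SmoothCoeffOn (p i) U) : SmoothCoeffOn (fun x => ∏ i ∈ s, p i x) U := by
  classical
  induction s using Finset.induction_on with
  | empty => simpa using const 1
  | insert i s hi ih =>
    simp only [Finset.prod_insert hi]
    exact (h i (by simp)).mul (ih fun j hj => h j (by simp [hj]))

theorem derivative (hp : SmoothCoeffOn p U) :
    SmoothCoeffOn (fun x => Polynomial.derivative (p x)) U := fun k => by
  simp only [coeff_derivative]
  exact (hp _).mul contDiffOn_const

theorem charpoly {ι : Type*} [Fintype ι] [DecidableEq ι] {a : E → Matrix ι ι ℂ}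
    (ha : ∀ i j, ContDiffOn ℝ ∞ (fun x => a x i j) U) :
    SmoothCoeffOn (fun x => (a x).charpoly) U := by
  simp only [Matrix.charpoly, Matrix.det_apply']
  refine sum fun σ _ => (const _).mul (prod fun i _ => ?_)
  simp only [Matrix.charmatrix_apply]
  exact (const _).sub (C (ha _ _))

theorem divByMonic_X_sub_C {d : ℕ} {r : E → ℂ} (hp : SmoothCoeffOn p U)
    (hdeg : ∀ x ∈ U, (p x).natDegree = d) (hr : ContDiffOn ℝ ∞ r U) :
    SmoothCoeffOn (fun x => p x /ₘ (X - Polynomial.C (r x))) U := fun k => by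
  refine ContDiffOn.congr (f := fun x => ∑ i ∈ Finset.Icc (k + 1) d,
    r x ^ (i - (k + 1)) * (p x).coeff i) (ContDiffOn.sum fun i _ => (hr.pow _).mul (hp i)) ?_
  intro x hx
  simp only [coeff_divByMonic_X_sub_C, hdeg x hx]

theorem contDiffOn_eval {d : ℕ} (hp : SmoothCoeffOn p U) (hdeg : ∀ x ∈ U, (p x).natDegree ≤ d) :
    ContDiffOn ℝ ∞ (fun v : E × ℂ => (p v.1).eval v.2) (U ×ˢ Set.univ) := by
  refine ContDiffOn.congr (f := fun v : E × ℂ => ∑ i ∈ Finset.range (d + 1),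
    (p v.1).coeff i * v.2 ^ i) (ContDiffOn.sum fun i _ => ?_) ?_
  · exact ((hp i).comp contDiffOn_fst fun v hv => hv.1).mul (contDiffOn_snd.pow i)
  · intro v hv
    exact eval_eq_sum_range' (Nat.lt_succ_of_le (hdeg _ hv.1)) _

theorem contDiffOn_eval_comp {d : ℕ} {r : E → ℂ} (hp : SmoothCoeffOn p U)
    (hdeg : ∀ x ∈ U, (p x).natDegree ≤ d) (hr : ContDiffOn ℝ ∞ r U) :
    ContDiffOn ℝ ∞ (fun x => (p x).eval (r x)) U :=
  (hp.contDiffOn_eval hdeg).comp (contDiffOn_id.prodMk hr) fun _ hx => ⟨hx, trivial⟩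

/-- A simple root of one member of a smooth family of polynomials extends to a smooth family of
roots on a neighbourhood of the parameter. -/
theorem exists_root_of_simple [CompleteSpace E] {d : ℕ} (hU : IsOpen U) (hp : SmoothCoeffOn p U)
    (hdeg : ∀ x ∈ U, (p x).natDegree ≤ d) {x₀ : E} (hx₀ : x₀ ∈ U) {z₀ : ℂ}
    (hz₀ : (p x₀).eval z₀ = 0) (hz₀' : (Polynomial.derivative (p x₀)).eval z₀ ≠ 0) :
    ∃ V : Set E, IsOpen V ∧ V.Nonempty ∧ V ⊆ U ∧ ∃ r : E → ℂ, ContDiffOn ℝ ∞ r V ∧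
      ∀ x ∈ V, (p x).eval (r x) = 0 := by
  have hopen : IsOpen (U ×ˢ (Set.univ : Set ℂ)) := hU.prod isOpen_univ
  have hf := hp.contDiffOn_eval hdeg
  have hf' := hp.derivative.contDiffOn_eval (d := d)
    fun x hx => (natDegree_derivative_le _).trans ((Nat.sub_le _ _).trans (hdeg x hx))
  have hWo := hf'.continuousOn.isOpen_inter_preimage hopen (isOpen_compl_singleton (x := (0 : ℂ)))
  have hinv : ∀ v ∈ (U ×ˢ Set.univ) ∩
      (fun v : E × ℂ => (Polynomial.derivative (p v.1)).eval v.2) ⁻¹' {0}ᶜ,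
      (fderiv ℝ (fun v : E × ℂ => (p v.1).eval v.2) v ∘L .inr ℝ E ℂ).IsInvertible := by
    rintro ⟨x, z⟩ ⟨hxz, hne⟩
    replace hne : (Polynomial.derivative (p x)).eval z ≠ 0 := hne
    have hd : HasFDerivAt (fun v : E × ℂ => (p v.1).eval v.2) _ (x, z) :=
      ((hf.contDiffAt (hopen.mem_nhds hxz)).differentiableAt (by simp)).hasFDerivAt
    have h₁ := hd.comp z (hasFDerivAt_prodMk_right x z)
    have h₂ := ((p x).hasDerivAt z).hasFDerivAt.restrictScalars ℝ
    rw [h₁.unique h₂]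
    refine ⟨(ContinuousLinearEquiv.unitsEquivAut ℂ (Units.mk0 _ hne)).restrictScalars ℝ, ?_⟩
    ext; simp
  obtain ⟨V, hV, hxV, r, hr, hVr⟩ := (hf.mono Set.inter_subset_left)
    |>.exists_contDiffOn_implicitFunction hWo hinv (u := (x₀, z₀)) ⟨⟨hx₀, trivial⟩, hz₀'⟩
  exact ⟨V, hV, ⟨x₀, hxV⟩, fun x hx => (hVr x hx).1.1.1, r, hr,
    fun x hx => (hVr x hx).2.trans hz₀⟩

/-- A smooth family of monic polynomials of fixed degree splits smoothly into linear factors over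
some nonempty open subset of the parameter space. -/
theorem exists_eq_prod_X_sub_C [CompleteSpace E] (d : ℕ) (hU : IsOpen U) (hne : U.Nonempty)
    (hp : SmoothCoeffOn p U) (hmonic : ∀ x ∈ U, (p x).Monic)
    (hdeg : ∀ x ∈ U, (p x).natDegree = d) :
    ∃ V : Set E, IsOpen V ∧ V.Nonempty ∧ V ⊆ U ∧ ∃ r : Fin d → E → ℂ,
      (∀ j, ContDiffOn ℝ ∞ (r j) V) ∧
      ∀ x ∈ V, p x = ∏ j, (X - Polynomial.C (r j x)) := by
  induction d generalizing p U with
  | zero =>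
    refine ⟨U, hU, hne, subset_rfl, fun _ _ => 0, fun j => j.elim0, fun x hx => ?_⟩
    simpa using (hmonic x hx).natDegree_eq_zero.1 (hdeg x hx)
  | succ d ih =>
    obtain ⟨V, hV, hVne, hVU, r, hr, hroot⟩ : ∃ V : Set E, IsOpen V ∧ V.Nonempty ∧ V ⊆ U ∧
        ∃ r : E → ℂ, ContDiffOn ℝ ∞ r V ∧ ∀ x ∈ V, (p x).eval (r x) = 0 := by
      by_cases hsimple : ∃ x ∈ U, ∃ z, (p x).eval z = 0 ∧
          (Polynomial.derivative (p x)).eval z ≠ 0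
      · obtain ⟨x, hx, z, hz, hz'⟩ := hsimple
        exact hp.exists_root_of_simple hU (fun y hy => (hdeg y hy).le) hx hz hz'
      push Not at hsimple
      have hd : (d + 1 : ℂ) ≠ 0 := by exact_mod_cast d.succ_ne_zero
      have hdm : ∀ x ∈ U,
          (Polynomial.C (d + 1 : ℂ)⁻¹ * Polynomial.derivative (p x)).natDegree = d := by
        intro x hx
        rw [natDegree_C_mul (inv_ne_zero hd), natDegree_derivative, hdeg x hx,
          Nat.add_sub_cancel]
      obtain ⟨V, hV, hVne, hVU, μ, hμ, hsplit⟩ := ih hU hne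
        ((const (Polynomial.C (d + 1 : ℂ)⁻¹)).mul hp.derivative) (fun x hx => by
          have hc : (p x).coeff (d + 1) = 1 := by
            simpa [hdeg x hx] using (hmonic x hx).coeff_natDegree
          rw [Monic, leadingCoeff, hdm x hx, coeff_C_mul, coeff_derivative, hc, one_mul,
            inv_mul_cancel₀ hd]) hdm
      have heval : ∀ j, ContDiffOn ℝ ∞ (fun x => (p x).eval (μ j x)) V := fun j =>
        (hp.mono hVU).contDiffOn_eval_comp (fun x hx => (hdeg x (hVU hx)).le) (hμ j)
      obtain ⟨j, -, W, hW, hWne, hWV, hW0⟩ := exists_isOpen_eqOn_zero_of_prod_eq_zero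
        Finset.univ (fun j x => (p x).eval (μ j x)) hV hVne
        (fun j _ => (heval j).continuousOn) (fun x hx => by
          obtain ⟨z, hz⟩ := IsAlgClosed.exists_root (p x) (by
            rw [degree_eq_natDegree (hmonic x (hVU hx)).ne_zero, hdeg x (hVU hx)]
            exact_mod_cast d.succ_ne_zero)
          have h0 := congrArg (eval z) (hsplit x hx)
          rw [eval_mul, hsimple x (hVU hx) z hz, mul_zero, eval_prod, eq_comm,
            Finset.prod_eq_zero_iff] at h0
          obtain ⟨j, -, hj⟩ := h0
          have hzj : z = μ j x := by simpa [sub_eq_zero] using hj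
          exact ⟨j, Finset.mem_univ _, hzj ▸ hz⟩)
      exact ⟨W, hW, hWne, hWV.trans hVU, μ j, (hμ j).mono hWV, hW0⟩
    have hfactor : ∀ x ∈ V,
        (X - Polynomial.C (r x)) * (p x /ₘ (X - Polynomial.C (r x))) = p x := fun x hx =>
      mul_divByMonic_eq_iff_isRoot.2 (hroot x hx)
    obtain ⟨W, hW, hWne, hWV, μ, hμ, hsplit⟩ := ih hV hVne
      ((hp.mono hVU).divByMonic_X_sub_C (fun x hx => hdeg x (hVU hx)) hr)
      (fun x hx => (monic_X_sub_C (r x)).of_mul_monic_left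
        (by rw [hfactor x hx]; exact hmonic x (hVU hx)))
      (fun x hx => by
        rw [natDegree_divByMonic _ (monic_X_sub_C _), hdeg x (hVU hx), natDegree_X_sub_C,
          Nat.add_sub_cancel])
    refine ⟨W, hW, hWne, hWV.trans hVU, Fin.cons r μ, fun j => ?_, fun x hx => ?_⟩
    · cases j using Fin.cases with
      | zero => simpa using hr.mono hWV
      | succ j => simpa using hμ j
    · rw [← hfactor x (hWV hx), hsplit x hx, Fin.prod_univ_succ]
      simp

end SmoothCoeffOn

end PolynomialFamily

/-- Lemma 3.3. If `a : U → ℂ^{N×N}` is smooth on a nonempty open set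
`U ⊆ ℝⁿ`, then there is a nonempty open subset `Ũ ⊆ U` on which the eigenvalues of `a(ξ)`
(counted with algebraic multiplicity) can be chosen as smooth functions `λ₁, …, λ_N`. -/
theorem smooth_eigenvalues_on_open_subset (n N : ℕ) (hn : 1 ≤ n) (hN : 1 ≤ N)
    (U : Set (EuclideanSpace ℝ (Fin n))) (hU : IsOpen U) (hUne : U.Nonempty)
    (a : EuclideanSpace ℝ (Fin n) → Matrix (Fin N) (Fin N) ℂ)
    (ha : ∀ i j, ContDiffOn ℝ (⊤ : ℕ∞) (fun ξ => a ξ i j) U) :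
    ∃ Ut : Set (EuclideanSpace ℝ (Fin n)), IsOpen Ut ∧ Ut.Nonempty ∧ Ut ⊆ U ∧
      ∃ lam : Fin N → EuclideanSpace ℝ (Fin n) → ℂ,
        (∀ j, ContDiffOn ℝ (⊤ : ℕ∞) (lam j) Ut) ∧
        ∀ ξ ∈ Ut, ∀ l : ℂ,
          (l • (1 : Matrix (Fin N) (Fin N) ℂ) - a ξ).det = ∏ j : Fin N, (l - lam j ξ) := by
  obtain ⟨V, hV, hVne, hVU, r, hr, hsplit⟩ := (SmoothCoeffOn.charpoly ha).exists_eq_prod_X_sub_C N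
    hU hUne (fun ξ _ => (a ξ).charpoly_monic) (fun ξ _ => by simp)
  refine ⟨V, hV, hVne, hVU, r, hr, fun ξ hξ l => ?_⟩
  rw [Matrix.smul_one_eq_diagonal, ← Matrix.scalar_apply, ← Matrix.eval_charpoly, hsplit ξ hξ, Polynomial.eval_prod]
  simp
end

section
/- Let U ⊆ ℝⁿ be open and nonempty, let a : U → ℂ^{N×N} be smooth, and let λ : U → ℂ be smooth such that λ(ξ) is an eigenvalue of a(ξ) (i.e., det(λ(ξ)·I_N − a(ξ)) = 0) for every ξ ∈ U. Then there exist a nonempty open set Ũ ⊆ U and a smooth function v : Ũ → ℂ^N such that v(ξ) ≠ 0 and a(ξ)v(ξ) = λ(ξ)v(ξ) for all ξ ∈ Ũ. -/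
open Matrix Complex

/-- A vector of signed maximal minors of a `k × (k + 1)` block of `M`, extended by zero. -/
noncomputable def Matrix.minorVector {R : Type*} [CommRing R] {N k : ℕ}
    (M : Matrix (Fin N) (Fin N) R) (r : Fin k → Fin N) (c : Fin (k + 1) → Fin N) : Fin N → R :=
  fun j => ∑ l, if c l = j then (-1) ^ (l : ℕ) * (M.submatrix r (c ∘ l.succAbove)).det else 0

/-- The entries of `M *ᵥ minorVector` are the bordered minors of `M`. -/
theorem Matrix.mulVec_minorVector {R : Type*} [CommRing R] {N k : ℕ}
    (M : Matrix (Fin N) (Fin N) R) (r : Fin k → Fin N) (c : Fin (k + 1) → Fin N) (i : Fin N) :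
    (M *ᵥ M.minorVector r c) i = (M.submatrix (Fin.cons i r : Fin (k + 1) → Fin N) c).det := by
  rw [Matrix.det_succ_row_zero]
  simp only [Matrix.mulVec, dotProduct, Matrix.minorVector, Finset.mul_sum]
  rw [Finset.sum_comm]
  refine Finset.sum_congr rfl fun l _ => ?_
  simp only [mul_ite, mul_zero, Finset.sum_ite_eq, Finset.mem_univ, if_true]
  have h : (M.submatrix (Fin.cons i r : Fin (k + 1) → Fin N) c).submatrix Fin.succ l.succAbove =
      M.submatrix r (c ∘ l.succAbove) := by
    ext p q
    simp
  rw [h]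
  simp only [Matrix.submatrix_apply, Fin.cons_zero]
  ring

/-- The entry of `minorVector` at a column not repeated in `c` is the complementary minor. -/
theorem Matrix.minorVector_cons {R : Type*} [CommRing R] {N k : ℕ}
    (M : Matrix (Fin N) (Fin N) R) (r c : Fin k → Fin N) (j : Fin N) (hj : j ∉ Set.range c) :
    M.minorVector r (Fin.cons j c : Fin (k + 1) → Fin N) j = (M.submatrix r c).det := by
  have h : ∀ l, c l ≠ j := fun l hl => hj ⟨l, hl⟩
  have hc : (Fin.cons j c : Fin (k + 1) → Fin N) ∘ Fin.succ = c := by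
    ext l
    simp
  simp [Matrix.minorVector, Fin.sum_univ_succ, h, hc]

/-- Selecting equal columns gives a zero minor. -/
theorem Matrix.injective_of_det_submatrix_ne_zero {R : Type*} [CommRing R] {N k : ℕ}
    {M : Matrix (Fin N) (Fin N) R} {r c : Fin k → Fin N} (h : (M.submatrix r c).det ≠ 0) :
    Function.Injective c := by
  intro p q hpq
  by_contra hne
  exact h (Matrix.det_zero_of_column_eq hne fun i => by simp [hpq])

/-- A nonzero minor of a singular matrix omits some column. -/
theorem Matrix.exists_notMem_range_of_det_submatrix_ne_zero {R : Type*} [CommRing R] {N k : ℕ}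
    {M : Matrix (Fin N) (Fin N) R} (hM : M.det = 0) {r c : Fin k → Fin N}
    (h : (M.submatrix r c).det ≠ 0) : ∃ j, j ∉ Set.range c := by
  by_contra! hc
  have hbij : Function.Bijective c := ⟨Matrix.injective_of_det_submatrix_ne_zero h, hc⟩
  have hk : k = N := by simpa using Fintype.card_of_bijective hbij
  subst hk
  apply h
  have hs : M.submatrix r c = (M.submatrix r id).submatrix id (Equiv.ofBijective c hbij) := by
    ext p q
    simp
  have hr : M.submatrix r id = (1 : Matrix (Fin k) (Fin k) R).submatrix r id * M := by
    ext p q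
    simp [Matrix.mul_apply, Matrix.one_apply]
  rw [hs, Matrix.det_permute', hr, Matrix.det_mul, hM]
  simp

/-- The determinant of a matrix with smooth entries is smooth. -/
theorem ContDiffOn.matrix_det {E : Type*} [NormedAddCommGroup E] [NormedSpace ℝ E] {k : ℕ}
    {m : WithTop ℕ∞} {U : Set E} {A : E → Matrix (Fin k) (Fin k) ℂ}
    (hA : ∀ i j, ContDiffOn ℝ m (fun x => A x i j) U) :
    ContDiffOn ℝ m (fun x => (A x).det) U := by
  simp only [Matrix.det_apply']
  exact ContDiffOn.sum fun σ _ => contDiffOn_const.mul (contDiffOn_prod fun i _ => hA _ _)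

/-- On a nonempty open set, a smooth family of singular matrices has a smooth nonvanishing
kernel vector field on some nonempty open subset. -/
theorem exists_smooth_kernel_vector {E : Type*} [NormedAddCommGroup E] [NormedSpace ℝ E] {N : ℕ}
    {m : WithTop ℕ∞} {U : Set E} (hU : IsOpen U) (hUne : U.Nonempty)
    {A : E → Matrix (Fin N) (Fin N) ℂ} (hA : ∀ i j, ContDiffOn ℝ m (fun x => A x i j) U)
    (hdet : ∀ x ∈ U, (A x).det = 0) :
    ∃ V : Set E, IsOpen V ∧ V.Nonempty ∧ V ⊆ U ∧ ∃ v : E → Fin N → ℂ,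
      (∀ i, ContDiffOn ℝ m (fun x => v x i) V) ∧ ∀ x ∈ V, v x ≠ 0 ∧ A x *ᵥ v x = 0 := by
  classical
  let P : ℕ → Prop := fun k => ∃ x ∈ U, ∃ r c : Fin k → Fin N, ((A x).submatrix r c).det ≠ 0
  have hP0 : P 0 := by
    obtain ⟨x, hx⟩ := hUne
    exact ⟨x, hx, Fin.elim0, Fin.elim0, by simp⟩
  have hPle : ∀ k, P k → k ≤ N := by
    rintro k ⟨x, _, r, c, h⟩
    simpa using Fintype.card_le_of_injective c (Matrix.injective_of_det_submatrix_ne_zero h)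
  obtain ⟨k, ⟨x₀, hx₀, r, c, hrc⟩, hmax⟩ : ∃ k, P k ∧ ¬ P (k + 1) := by
    by_contra! hstep
    have hall : ∀ k, P k := fun k => Nat.rec hP0 hstep k
    exact absurd (hPle _ (hall (N + 1))) (by omega)
  obtain ⟨j, hj⟩ :=
    Matrix.exists_notMem_range_of_det_submatrix_ne_zero (hdet x₀ hx₀) hrc
  have hsmooth : ∀ {l : ℕ} (r c : Fin l → Fin N),
      ContDiffOn ℝ m (fun x => ((A x).submatrix r c).det) U :=
    fun r c => ContDiffOn.matrix_det fun p q => hA _ _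
  refine ⟨U ∩ (fun x => ((A x).submatrix r c).det) ⁻¹' {0}ᶜ,
    (hsmooth r c).continuousOn.isOpen_inter_preimage hU isOpen_compl_singleton,
    ⟨x₀, hx₀, hrc⟩, Set.inter_subset_left,
    fun x => (A x).minorVector r (Fin.cons j c : Fin (k + 1) → Fin N), fun i => ?_, ?_⟩
  · refine ContDiffOn.mono (ContDiffOn.sum fun l _ => ?_) Set.inter_subset_left
    split_ifs
    · exact contDiffOn_const.mul (hsmooth _ _)
    · exact contDiffOn_const
  · rintro x ⟨hx, hne⟩
    refine ⟨fun h0 => hne ?_, ?_⟩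
    · exact (Matrix.minorVector_cons _ _ _ _ hj).symm.trans (congrFun h0 j)
    · ext i
      rw [Matrix.mulVec_minorVector]
      by_contra h
      exact hmax ⟨x, hx, _, _, h⟩

/-- Lemma 3.4. If `a : U → ℂ^{N×N}` and an eigenvalue function
`λ : U → ℂ` are smooth on a nonempty open set `U ⊆ ℝⁿ`, then on some nonempty open subset
`Ũ ⊆ U` there is a smooth nonvanishing eigenvector field `v` with `a(ξ)v(ξ) = λ(ξ)v(ξ)`. -/
theorem smooth_eigenvector_on_open_subset (n N : ℕ) (hn : 1 ≤ n) (hN : 1 ≤ N)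
    (U : Set (EuclideanSpace ℝ (Fin n))) (hU : IsOpen U) (hUne : U.Nonempty)
    (a : EuclideanSpace ℝ (Fin n) → Matrix (Fin N) (Fin N) ℂ)
    (ha : ∀ i j, ContDiffOn ℝ (⊤ : ℕ∞) (fun ξ => a ξ i j) U)
    (lam : EuclideanSpace ℝ (Fin n) → ℂ) (hlam : ContDiffOn ℝ (⊤ : ℕ∞) lam U)
    (heig : ∀ ξ ∈ U, (lam ξ • (1 : Matrix (Fin N) (Fin N) ℂ) - a ξ).det = 0) :
    ∃ Ut : Set (EuclideanSpace ℝ (Fin n)), IsOpen Ut ∧ Ut.Nonempty ∧ Ut ⊆ U ∧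
      ∃ v : EuclideanSpace ℝ (Fin n) → Fin N → ℂ,
        (∀ i, ContDiffOn ℝ (⊤ : ℕ∞) (fun ξ => v ξ i) Ut) ∧
        ∀ ξ ∈ Ut, v ξ ≠ 0 ∧ (a ξ).mulVec (v ξ) = lam ξ • v ξ := by
  obtain ⟨V, hV, hVne, hVU, v, hv, hker⟩ := exists_smooth_kernel_vector
    (A := fun ξ => lam ξ • (1 : Matrix (Fin N) (Fin N) ℂ) - a ξ) hU hUne
    (fun i j => (hlam.mul contDiffOn_const).sub (ha i j)) heig
  refine ⟨V, hV, hVne, hVU, v, hv, fun ξ hξ => ⟨(hker ξ hξ).1, ?_⟩⟩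
  have h := (hker ξ hξ).2
  rw [Matrix.sub_mulVec, Matrix.smul_mulVec, Matrix.one_mulVec, sub_eq_zero] at h
  exact h.symm
end

section
/- Let n, N ≥ 1, R > 0, let V ⊆ S^{n−1} be open and nonempty, d ∈ ℝ, and let a : S_{R,V} → ℂ^{N×N} be smooth with a(tξ) = t^d a(ξ) for all ξ ∈ S_{R,V} and all t > 1 (homogeneous of degree d in S_{R,V}). Then there exist a nonempty open set Ṽ ⊆ V and smooth functions λ : S_{R,Ṽ} → ℂ and v : S_{R,Ṽ} → ℂ^N such that for all ξ ∈ S_{R,Ṽ}: v(ξ) ≠ 0, a(ξ)v(ξ) = λ(ξ)v(ξ), and for all t > 1 one has λ(tξ) = t^d λ(ξ) and v(tξ) = t^d v(ξ). -/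
open Matrix Complex

noncomputable section

/-- The truncated cone `S_{R,V} = {r·η : r > R, η ∈ V}` over a subset `V` of the unit
sphere. -/
def truncCone {n : ℕ} (R : ℝ) (V : Set (EuclideanSpace ℝ (Fin n))) :
    Set (EuclideanSpace ℝ (Fin n)) :=
  {ξ | ∃ r : ℝ, R < r ∧ ∃ η ∈ V, ξ = r • η}

section Roots

open Polynomial Filter Topology

theorem eventually_exists_isRoot_near {X : Type*} [TopologicalSpace X]
    {p : X → Polynomial ℂ} {m : ℕ} {x : X} {z : ℂ}
    (hmonic : ∀ y, (p y).Monic) (hdeg : ∀ y, (p y).natDegree = m)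
    (hc : ContinuousAt (fun y => (p y).eval z) x) (hz : (p x).IsRoot z) {ε : ℝ} (hε : 0 < ε) :
    ∀ᶠ y in 𝓝 x, ∃ w, (p y).IsRoot w ∧ dist w z < ε := by
  have hlim : Tendsto (fun y => ‖(p y).eval z‖) (𝓝 x) (𝓝 0) := by
    have := hc.norm.tendsto
    rwa [hz.eq_zero, norm_zero] at this
  filter_upwards [hlim.eventually_lt_const (pow_pos hε m)] with y hy
  by_contra! hfar
  refine hy.not_ge ?_
  have hsplit := IsAlgClosed.splits (p y)
  have hcard : (p y).roots.card = m := by rw [← hdeg y, hsplit.natDegree_eq_card_roots]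
  rw [hsplit.eval_eq_prod_roots_of_monic (hmonic y)]
  have key : ∀ s : Multiset ℂ, (∀ w ∈ s, ε ≤ dist w z) →
      ε ^ s.card ≤ ‖(s.map fun a => z - a).prod‖ := by
    intro s
    induction s using Multiset.induction_on with
    | empty => simp
    | cons a s ih =>
      intro h
      have ha : ε ≤ ‖z - a‖ := by
        rw [← dist_eq_norm, dist_comm]
        exact h a (by simp)
      have hs := ih fun w hw => h w (by simp [hw])
      rw [Multiset.card_cons, pow_succ', Multiset.map_cons, Multiset.prod_cons, norm_mul]
      gcongr
  rw [← hcard]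
  exact key _ fun w hw => hfar w (isRoot_of_mem_roots hw)

variable {E : Type*} [NormedAddCommGroup E] [NormedSpace ℝ E]

theorem contDiffAt_polynomial_eval {n : WithTop ℕ∞} {q : E → ℂ[X]} {m : ℕ} {x : E}
    (hdeg : ∀ y, (q y).natDegree ≤ m)
    (hc : ∀ i, ContDiffAt ℝ n (fun y => (q y).coeff i) x) (z : ℂ) :
    ContDiffAt ℝ n (fun u : E × ℂ => (q u.1).eval u.2) (x, z) := by
  have h : (fun u : E × ℂ => (q u.1).eval u.2) =
      fun u => ∑ i ∈ Finset.range (m + 1), (q u.1).coeff i * u.2 ^ i := by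
    funext u
    exact eval_eq_sum_range' (Nat.lt_succ_of_le (hdeg u.1)) _
  rw [h]
  refine ContDiffAt.sum fun i _ => ContDiffAt.mul ?_ (contDiffAt_snd.pow i)
  exact ContDiffAt.comp (x, z) (hc i) contDiffAt_fst

variable [CompleteSpace E]

theorem exists_local_root_branch {p : E → ℂ[X]} {m k : ℕ} {Ω : Set E} {x : E} {z : ℂ}
    (hΩ : IsOpen Ω) (hx : x ∈ Ω)
    (hmonic : ∀ y, (p y).Monic) (hdeg : ∀ y, (p y).natDegree = m)
    (hc : ∀ i, ContDiffOn ℝ (⊤ : ℕ∞) (fun y => (p y).coeff i) Ω)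
    (hroot : ∀ y ∈ Ω, ∀ w, (p y).IsRoot w → (derivative^[k] (p y)).IsRoot w)
    (hz : (p x).IsRoot z) (hsimple : (derivative^[k + 1] (p x)).eval z ≠ 0) :
    ∃ φ : E → ℂ, ContDiffAt ℝ (⊤ : ℕ∞) φ x ∧ φ x = z ∧
      (∀ᶠ y in 𝓝 x, (p y).IsRoot (φ y)) ∧
      ∀ᶠ u in 𝓝 (x, z), (p u.1).IsRoot u.2 → φ u.1 = u.2 := by
  have hcx : ∀ i, ContDiffAt ℝ (⊤ : ℕ∞) (fun y => (p y).coeff i) x := fun i =>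
    (hc i).contDiffAt (hΩ.mem_nhds hx)
  have hf : ContDiffAt ℝ (⊤ : ℕ∞) (fun u : E × ℂ => (derivative^[k] (p u.1)).eval u.2)
      (x, z) := by
    refine contDiffAt_polynomial_eval (m := m) (q := fun y => derivative^[k] (p y))
      (fun y => ?_) (fun i => ?_) z
    · exact (natDegree_iterate_derivative _ _).trans (by rw [hdeg]; exact Nat.sub_le _ _)
    · simp only [coeff_iterate_derivative, nsmul_eq_mul]
      exact contDiffAt_const.mul (hcx _)
  set f : E × ℂ → ℂ := fun u => (derivative^[k] (p u.1)).eval u.2 with hf_def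
  have hfx : f (x, z) = 0 := hroot x hx z hz
  have hne : ((⊤ : ℕ∞) : WithTop ℕ∞) ≠ 0 := by simp
  have hinv : (fderiv ℝ f (x, z) ∘L .inr ℝ E ℂ).IsInvertible := by
    have h1 : HasFDerivAt (fun w : ℂ => f (x, w)) (fderiv ℝ f (x, z) ∘L .inr ℝ E ℂ) z :=
      HasFDerivAt.comp z (hf.differentiableAt hne).hasFDerivAt (hasFDerivAt_prodMk_right (𝕜 := ℝ) x z)
    have h2 : HasDerivAt (fun w : ℂ => f (x, w)) ((derivative^[k + 1] (p x)).eval z) z := by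
      rw [Function.iterate_succ_apply']
      exact (derivative^[k] (p x)).hasDerivAt z
    have h3 := h1.unique h2.complexToReal_fderiv
    rw [h3]
    refine ⟨ContinuousLinearEquiv.smulLeft (R₁ := ℝ) (Units.mk0 _ hsimple), ?_⟩
    ext
    simp
  have htend : Tendsto (fun y => (y, hf.implicitFunction hne hinv y)) (𝓝 x) (𝓝 (x, z)) := by
    have := (hf.contDiffAt_implicitFunction hne hinv).continuousAt.tendsto
    rw [hf.implicitFunction_apply_self hne hinv] at this
    exact tendsto_id.prodMk_nhds this
  have huniq : ∀ᶠ u in 𝓝 (x, z),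
      (p u.1).IsRoot u.2 → hf.implicitFunction hne hinv u.1 = u.2 := by
    filter_upwards [hf.eventually_apply_eq_iff_implicitFunction hne hinv,
      continuousAt_fst.eventually_mem (hΩ.mem_nhds hx)] with u hu huΩ hur
    exact hu.1 (by rw [hfx]; exact hroot _ huΩ _ hur)
  refine ⟨hf.implicitFunction hne hinv, hf.contDiffAt_implicitFunction hne hinv,
    hf.implicitFunction_apply_self hne hinv, ?_, huniq⟩
  obtain ⟨s, hs, t, ht, hst⟩ := mem_nhds_prod_iff.1 huniq
  obtain ⟨ε, hε, hball⟩ := Metric.mem_nhds_iff.1 ht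
  have hcont : ContinuousAt (fun y => (p y).eval z) x :=
    (contDiffAt_polynomial_eval (fun y => (hdeg y).le) hcx z).continuousAt.comp
      (f := fun y => (y, z)) (by fun_prop)
  filter_upwards [hs, eventually_exists_isRoot_near hmonic hdeg hcont hz hε] with y hys ⟨w, hw, hwz⟩
  have : hf.implicitFunction hne hinv y = w :=
    hst (Set.mk_mem_prod hys (hball (Metric.mem_ball.2 hwz))) hw
  rwa [this]

/-- A family of monic polynomials of positive degree with smooth coefficients has a smooth root
over some nonempty open subset of the parameter space. -/
theorem exists_contDiffOn_root {p : E → ℂ[X]} {m : ℕ} {Ω : Set E}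
    (hΩ : IsOpen Ω) (hne : Ω.Nonempty) (hm : m ≠ 0)
    (hmonic : ∀ y, (p y).Monic) (hdeg : ∀ y, (p y).natDegree = m)
    (hc : ∀ i, ContDiffOn ℝ (⊤ : ℕ∞) (fun y => (p y).coeff i) Ω) :
    ∃ W ⊆ Ω, IsOpen W ∧ W.Nonempty ∧ ∃ φ : E → ℂ, ContDiffOn ℝ (⊤ : ℕ∞) φ W ∧
      ∀ y ∈ W, (p y).IsRoot (φ y) := by
  classical
  have hex : ∃ k, ∃ y ∈ Ω, ∃ w, (p y).IsRoot w ∧ (derivative^[k] (p y)).eval w ≠ 0 := by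
    obtain ⟨y, hy⟩ := hne
    obtain ⟨w, hw⟩ := IsAlgClosed.exists_root (p y)
      (by rw [degree_eq_natDegree (hmonic y).ne_zero, hdeg]; exact_mod_cast hm)
    refine ⟨m, y, hy, w, hw, ?_⟩
    have hd : derivative^[m] (p y) = C ((m.factorial : ℂ)) := by
      have h0 : (derivative^[m] (p y)).natDegree = 0 := by
        have := natDegree_iterate_derivative (p y) m
        rw [hdeg] at this; omega
      rw [eq_C_of_natDegree_eq_zero h0, coeff_iterate_derivative, zero_add]
      have := (hmonic y).coeff_natDegree
      rw [hdeg] at this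
      simp [this, Nat.descFactorial_self]
    rw [hd, eval_C]
    exact_mod_cast m.factorial_ne_zero
  obtain ⟨x, hx, z, hz, hkz⟩ := Nat.find_spec hex
  have hmin := fun j (hj : j < Nat.find hex) => Nat.find_min hex hj
  rcases h : Nat.find hex with _ | k
  · rw [h] at hkz
    exact absurd hz hkz
  rw [h] at hkz
  have hroot : ∀ y ∈ Ω, ∀ w, (p y).IsRoot w → (derivative^[k] (p y)).IsRoot w := by
    intro y hy w hw
    by_contra hcon
    exact hmin k (by omega) ⟨y, hy, w, hw, hcon⟩
  obtain ⟨φ, hφ, hφx, hφroot, -⟩ :=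
    exists_local_root_branch hΩ hx hmonic hdeg hc hroot hz hkz
  have hφcont : ∀ᶠ y in 𝓝 x, ContinuousAt φ y := by
    filter_upwards [(hφ.of_le (m := 1) (by exact_mod_cast le_top)).eventually (by simp)] with y hy
    exact hy.continuousAt
  have hder : ∀ᶠ y in 𝓝 x, (derivative^[k + 1] (p y)).eval (φ y) ≠ 0 := by
    have h1 : ContDiffAt ℝ (⊤ : ℕ∞)
        (fun u : E × ℂ => (derivative^[k + 1] (p u.1)).eval u.2) (x, φ x) := by
      refine contDiffAt_polynomial_eval (m := m) (q := fun y => derivative^[k + 1] (p y))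
        (fun y => ?_) (fun i => ?_) _
      · exact (natDegree_iterate_derivative _ _).trans (by rw [hdeg]; exact Nat.sub_le _ _)
      · simp only [coeff_iterate_derivative, nsmul_eq_mul]
        exact contDiffAt_const.mul ((hc _).contDiffAt (hΩ.mem_nhds hx))
    have h2 : ContinuousAt (fun y => (derivative^[k + 1] (p y)).eval (φ y)) x :=
      h1.continuousAt.comp (f := fun y => (y, φ y)) (continuousAt_id.prodMk hφ.continuousAt)
    exact h2.eventually_ne (by rwa [hφx])
  obtain ⟨W, hW, hWo, hxW⟩ := eventually_nhds_iff.1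
    (((hφroot.and hφcont).and hder).and (hΩ.mem_nhds hx))
  refine ⟨W, fun y hy => (hW y hy).2, hWo, ⟨x, hxW⟩, φ, fun y hy => ?_,
    fun y hy => (hW y hy).1.1.1⟩
  obtain ⟨⟨⟨hy1, hy2⟩, hy3⟩, hyΩ⟩ := hW y hy
  obtain ⟨ψ, hψ, -, -, hψu⟩ := exists_local_root_branch hΩ hyΩ hmonic hdeg hc hroot hy1 hy3
  refine (hψ.congr_of_eventuallyEq ?_).contDiffWithinAt
  have ht : Tendsto (fun y' => (y', φ y')) (𝓝 y) (𝓝 (y, φ y)) :=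
    tendsto_id.prodMk_nhds hy2.tendsto
  filter_upwards [ht.eventually hψu, hWo.mem_nhds hy] with y' h1 h2
  exact (h1 (hW y' h2).1.1.1).symm

end Roots

section Kernels

theorem LinearMap.exists_add_injective_finrank_range_le {K U : Type*} [Field K] [AddCommGroup U]
    [Module K U] [FiniteDimensional K U] (f : U →ₗ[K] U) :
    ∃ g : U →ₗ[K] U, Function.Injective (f + g) ∧
      Module.finrank K f.range + Module.finrank K g.range ≤ Module.finrank K U := by
  obtain ⟨C, hC⟩ := f.ker.exists_isCompl
  obtain ⟨D, hD⟩ := f.range.exists_isCompl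
  have hfin : Module.finrank K f.ker = Module.finrank K D := by
    have h1 := f.finrank_range_add_finrank_ker
    have h2 := Submodule.finrank_add_eq_of_isCompl hD
    omega
  let e : f.ker ≃ₗ[K] D := LinearEquiv.ofFinrankEq _ _ hfin
  let g : U →ₗ[K] U := D.subtype ∘ₗ e.toLinearMap ∘ₗ f.ker.projectionOnto C hC
  have hg : g.range ≤ D := by
    rintro _ ⟨u, rfl⟩
    exact Subtype.property _
  refine ⟨g, ?_, ?_⟩
  · rw [← LinearMap.ker_eq_bot, LinearMap.ker_eq_bot']
    intro u hu
    have hfu : f u = - g u := eq_neg_of_add_eq_zero_left hu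
    have hf0 : f u = 0 := by
      refine (Submodule.disjoint_def.1 hD.disjoint) _ ⟨u, rfl⟩ ?_
      rw [hfu]
      exact D.neg_mem (hg ⟨u, rfl⟩)
    have hg0 : g u = 0 := by simpa [hf0] using hfu
    have h3 : g u = (e ⟨u, hf0⟩ : U) := by
      have := Submodule.projectionOnto_apply_left hC ⟨u, hf0⟩
      simp only [g, LinearMap.comp_apply]
      rw [this]; rfl
    rw [h3] at hg0
    have h4 : (⟨u, hf0⟩ : f.ker) = 0 := by simpa using hg0
    exact congrArg Subtype.val h4
  · have h2 := Submodule.finrank_add_eq_of_isCompl hD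
    have := Submodule.finrank_mono hg
    omega

/-- If `A + Q` is invertible and the ranks of `A` and `Q` add up to at most the size, then
`adjugate (A + Q) * Q` maps into the kernel of `A`. -/
theorem Matrix.mulVec_adjugate_add_eq_zero {K ι : Type*} [Field K] [Fintype ι] [DecidableEq ι]
    {A Q : Matrix ι ι K} (hdet : (A + Q).det ≠ 0)
    (hrank : A.rank + Q.rank ≤ Fintype.card ι) (u : ι → K) :
    A *ᵥ ((A + Q).adjugate *ᵥ (Q *ᵥ u)) = 0 := by
  set w := (A + Q).adjugate *ᵥ (Q *ᵥ u) with hw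
  have hS : (A + Q) *ᵥ w = (A + Q).det • (Q *ᵥ u) := by
    rw [hw, mulVec_mulVec, mul_adjugate, smul_mulVec, one_mulVec]
  have hAw : A *ᵥ w = Q *ᵥ ((A + Q).det • u - w) := by
    rw [mulVec_sub, mulVec_smul, ← hS, add_mulVec, add_sub_cancel_right]
  have htop : A.mulVecLin.range ⊔ Q.mulVecLin.range = ⊤ := by
    rw [eq_top_iff]
    intro y _
    have hy : y = (A + Q) *ᵥ ((A + Q)⁻¹ *ᵥ y) := by
      rw [mulVec_mulVec, mul_nonsing_inv _ (isUnit_iff_ne_zero.2 hdet), one_mulVec]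
    rw [hy, add_mulVec]
    exact Submodule.add_mem_sup ⟨_, rfl⟩ ⟨_, rfl⟩
  have hdim := Submodule.finrank_sup_add_finrank_inf_eq A.mulVecLin.range Q.mulVecLin.range
  rw [htop, finrank_top, Module.finrank_fintype_fun_eq_card] at hdim
  have hinf : A.mulVecLin.range ⊓ Q.mulVecLin.range = ⊥ := by
    rw [← Submodule.finrank_eq_zero]
    simp only [Matrix.rank] at hrank
    omega
  have hmem : A *ᵥ w ∈ A.mulVecLin.range ⊓ Q.mulVecLin.range :=
    ⟨⟨w, rfl⟩, by rw [hAw]; exact ⟨_, rfl⟩⟩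
  rwa [hinf, Submodule.mem_bot] at hmem

variable {E : Type*} [NormedAddCommGroup E] [NormedSpace ℝ E] {ι : Type*} [Fintype ι]
  [DecidableEq ι]

theorem contDiffOn_matrix_det {n : WithTop ℕ∞} {s : Set E} {A : E → Matrix ι ι ℂ}
    (hA : ∀ i j, ContDiffOn ℝ n (fun x => A x i j) s) :
    ContDiffOn ℝ n (fun x => (A x).det) s := by
  simp only [det_apply']
  exact ContDiffOn.sum fun σ _ => contDiffOn_const.mul (contDiffOn_prod fun i _ => hA _ _)

theorem contDiffOn_matrix_adjugate {n : WithTop ℕ∞} {s : Set E} {A : E → Matrix ι ι ℂ}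
    (hA : ∀ i j, ContDiffOn ℝ n (fun x => A x i j) s) (i j : ι) :
    ContDiffOn ℝ n (fun x => (A x).adjugate i j) s := by
  simp only [adjugate_apply]
  refine contDiffOn_matrix_det fun k l => ?_
  by_cases h : k = j
  · subst h
    simpa using contDiffOn_const
  · simpa [updateRow_ne h] using hA k l

theorem contDiffOn_charpoly_coeff {n : WithTop ℕ∞} {s : Set E} {A : E → Matrix ι ι ℂ}
    (hA : ∀ i j, ContDiffOn ℝ n (fun x => A x i j) s) (k : ℕ) :
    ContDiffOn ℝ n (fun x => (A x).charpoly.coeff k) s := by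
  have h : ∀ x, (A x).charpoly.coeff k =
      MvPolynomial.eval (fun ij : ι × ι => A x ij.1 ij.2) ((charpoly.univ ℂ ι).coeff k) := fun x =>
    (charpoly.univ_coeff_eval₂Hom ι (RingHom.id ℂ) (fun ij : ι × ι => A x ij.1 ij.2) k).symm
  simp only [h, MvPolynomial.eval_eq]
  exact ContDiffOn.sum fun σ _ => contDiffOn_const.mul
    (contDiffOn_prod fun i _ => (hA _ _).pow _)

/-- A smooth family of singular matrices has a smooth nonvanishing kernel field over some nonempty
open subset of the parameter space. -/
theorem exists_contDiffOn_kernel_vector {n : WithTop ℕ∞} {W : Set E} {A : E → Matrix ι ι ℂ}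
    (hW : IsOpen W)
    (hne : W.Nonempty) (hA : ∀ i j, ContDiffOn ℝ n (fun x => A x i j) W)
    (hsing : ∀ x ∈ W, (A x).det = 0) :
    ∃ W' ⊆ W, IsOpen W' ∧ W'.Nonempty ∧ ∃ v : E → ι → ℂ,
      (∀ i, ContDiffOn ℝ n (fun x => v x i) W') ∧
      ∀ x ∈ W', v x ≠ 0 ∧ A x *ᵥ v x = 0 := by
  obtain ⟨x₀, hx₀, hmax⟩ : ∃ x₀ ∈ W, ∀ x ∈ W, (A x).rank ≤ (A x₀).rank := by
    have hfin : ((fun x => (A x).rank) '' W).Finite :=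
      (Set.finite_Iic (Fintype.card ι)).subset (by
        rintro _ ⟨x, -, rfl⟩
        exact (A x).rank_le_card_width)
    obtain ⟨_, ⟨x₀, hx₀, rfl⟩, h⟩ := hfin.exists_maximal (hne.image _)
    refine ⟨x₀, hx₀, fun x hx => ?_⟩
    by_contra! hlt
    exact hlt.not_ge (h ⟨x, hx, rfl⟩ hlt.le)
  obtain ⟨g, hg, hrank⟩ := (A x₀).mulVecLin.exists_add_injective_finrank_range_le
  set Q : Matrix ι ι ℂ := LinearMap.toMatrix' g with hQ
  have hQg : Q.mulVecLin = g := by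
    rw [← Matrix.toLin'_apply', hQ, Matrix.toLin'_toMatrix']
  have hrank' : (A x₀).rank + Q.rank ≤ Fintype.card ι := by
    rwa [Matrix.rank, Matrix.rank, hQg, ← Module.finrank_fintype_fun_eq_card ℂ]
  have hdet₀ : (A x₀ + Q).det ≠ 0 := by
    rw [← isUnit_iff_ne_zero, ← isUnit_iff_isUnit_det, ← mulVec_injective_iff_isUnit]
    have : (A x₀ + Q).mulVec = ((A x₀).mulVecLin + g) := by
      funext u
      rw [← hQg, add_mulVec]; rfl
    rwa [this]
  obtain ⟨u, hu0, hu⟩ := exists_mulVec_eq_zero_iff.2 (hsing x₀ hx₀)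
  have hQu : Q *ᵥ u ≠ 0 := fun h => hu0 (hg (by
    rw [map_zero, LinearMap.add_apply, ← hQg, mulVecLin_apply, mulVecLin_apply, hu, h, add_zero]))
  have hAQ : ∀ i j, ContDiffOn ℝ n (fun x => (A x + Q) i j) W := fun i j =>
    (hA i j).add contDiffOn_const
  have hdetc : ContDiffOn ℝ n (fun x => (A x + Q).det) W := contDiffOn_matrix_det hAQ
  refine ⟨W ∩ (fun x => (A x + Q).det) ⁻¹' {0}ᶜ, Set.inter_subset_left,
    hdetc.continuousOn.isOpen_inter_preimage hW isOpen_compl_singleton, ⟨x₀, hx₀, hdet₀⟩,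
    fun x => (A x + Q).adjugate *ᵥ (Q *ᵥ u), fun i => ?_, ?_⟩
  · refine ContDiffOn.mono ?_ Set.inter_subset_left
    exact ContDiffOn.sum fun j _ => (contDiffOn_matrix_adjugate hAQ i j).mul contDiffOn_const
  · rintro x ⟨hx, hxdet⟩
    refine ⟨fun h => hQu ?_, mulVec_adjugate_add_eq_zero hxdet
      ((Nat.add_le_add_right (hmax x hx) _).trans hrank') u⟩
    have h2 : (A x + Q) *ᵥ ((A x + Q).adjugate *ᵥ (Q *ᵥ u)) = (A x + Q).det • (Q *ᵥ u) := by
      rw [mulVec_mulVec, mul_adjugate, smul_mulVec, one_mulVec]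
    rw [show (A x + Q).adjugate *ᵥ (Q *ᵥ u) = 0 from h, mulVec_zero] at h2
    exact (smul_eq_zero.1 h2.symm).resolve_left hxdet

end Kernels

/-- A smooth family of square matrices has a smooth eigenpair over some nonempty open subset of the
parameter space. -/
theorem exists_contDiffOn_eigenpair {E ι : Type*} [NormedAddCommGroup E] [NormedSpace ℝ E]
    [CompleteSpace E] [Fintype ι] [DecidableEq ι] [Nonempty ι] {Ω : Set E} {A : E → Matrix ι ι ℂ}
    (hΩ : IsOpen Ω) (hne : Ω.Nonempty)
    (hA : ∀ i j, ContDiffOn ℝ (⊤ : ℕ∞) (fun x => A x i j) Ω) :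
    ∃ W ⊆ Ω, IsOpen W ∧ W.Nonempty ∧ ∃ (φ : E → ℂ) (v : E → ι → ℂ),
      ContDiffOn ℝ (⊤ : ℕ∞) φ W ∧ (∀ i, ContDiffOn ℝ (⊤ : ℕ∞) (fun x => v x i) W) ∧
      ∀ x ∈ W, v x ≠ 0 ∧ A x *ᵥ v x = φ x • v x := by
  obtain ⟨W, hWΩ, hWo, hWne, φ, hφ, hroot⟩ := exists_contDiffOn_root hΩ hne
    (Fintype.card_ne_zero (α := ι)) (fun x => (A x).charpoly_monic)
    (fun x => (A x).charpoly_natDegree_eq_dim) (contDiffOn_charpoly_coeff hA)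
  obtain ⟨W', hW'W, hW'o, hW'ne, v, hv, hker⟩ := exists_contDiffOn_kernel_vector
    (n := (⊤ : ℕ∞)) (A := fun x => Matrix.scalar ι (φ x) - A x) hWo hWne
    (fun i j => by
      refine ContDiffOn.sub ?_ ((hA i j).mono hWΩ)
      by_cases h : i = j
      · subst h
        simpa using hφ
      · simpa [Matrix.diagonal_apply_ne _ h] using contDiffOn_const)
    (fun x hx => by rw [← eval_charpoly]; exact hroot x hx)
  refine ⟨W', hW'W.trans hWΩ, hW'o, hW'ne, φ, v, hφ.mono hW'W, hv, fun x hx => ?_⟩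
  obtain ⟨h0, h1⟩ := hker x hx
  refine ⟨h0, ?_⟩
  rw [sub_mulVec, sub_eq_zero] at h1
  rw [← h1, scalar_apply, ← smul_one_eq_diagonal, smul_mulVec, one_mulVec]

theorem norm_pos_and_normalize_mem_of_mem_truncCone {n : ℕ} {R : ℝ} (hR : 0 < R)
    {V : Set (EuclideanSpace ℝ (Fin n))} (hV : V ⊆ Metric.sphere 0 1)
    {ξ : EuclideanSpace ℝ (Fin n)} (hξ : ξ ∈ truncCone R V) :
    R < ‖ξ‖ ∧ ‖ξ‖⁻¹ • ξ ∈ V := by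
  obtain ⟨r, hr, η, hη, rfl⟩ := hξ
  have hη1 : ‖η‖ = 1 := by simpa using hV hη
  have hr0 : 0 < r := hR.trans hr
  have hnorm : ‖r • η‖ = r := by rw [norm_smul, hη1, mul_one, Real.norm_of_nonneg hr0.le]
  rw [hnorm, smul_smul, inv_mul_cancel₀ hr0.ne', one_smul]
  exact ⟨hr, hη⟩

theorem eq_rpow_smul_of_homogeneous {n : ℕ} {R : ℝ} (hR : 0 < R) {d : ℝ}
    {V : Set (EuclideanSpace ℝ (Fin n))} {M : Type*} [AddCommGroup M] [Module ℝ M]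
    {a : EuclideanSpace ℝ (Fin n) → M}
    (hhom : ∀ ξ ∈ truncCone R V, ∀ t : ℝ, 1 < t → a (t • ξ) = (t ^ d : ℝ) • a ξ)
    {η : EuclideanSpace ℝ (Fin n)} (hη : η ∈ V) {r s : ℝ} (hr : R < r) (hs : R < s) :
    a (r • η) = ((r / s) ^ d : ℝ) • a (s • η) := by
  have hr0 := hR.trans hr
  have hs0 := hR.trans hs
  have key : ∀ {r s : ℝ}, R < s → s < r → a (r • η) = ((r / s) ^ d : ℝ) • a (s • η) := by
    intro r s hs hsr
    have hs0 := hR.trans hs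
    rw [← hhom _ ⟨s, hs, η, hη, rfl⟩ _ ((one_lt_div hs0).2 hsr), smul_smul,
      div_mul_cancel₀ _ hs0.ne']
  rcases lt_trichotomy s r with h | rfl | h
  · exact key hs h
  · rw [div_self hs0.ne', Real.one_rpow, one_smul]
  · rw [key hr h, smul_smul, ← Real.mul_rpow (by positivity) (by positivity),
      div_mul_div_cancel₀ hs0.ne', div_self hr0.ne', Real.one_rpow, one_smul]

theorem contDiffOn_homogeneous_extension {E F : Type*} [NormedAddCommGroup E]
    [InnerProductSpace ℝ E] [NormedAddCommGroup F] [NormedSpace ℝ F] {n : WithTop ℕ∞}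
    {f : E → F} {W S : Set E} (hf : ContDiffOn ℝ n f W) (ρ s d : ℝ) (hρ : 0 < ρ)
    (hS : ∀ ξ ∈ S, ξ ≠ 0 ∧ s • ‖ξ‖⁻¹ • ξ ∈ W) :
    ContDiffOn ℝ n (fun ξ => ((‖ξ‖ / ρ) ^ d : ℝ) • f (s • ‖ξ‖⁻¹ • ξ)) S := by
  have hnorm : ContDiffOn ℝ n (fun ξ : E => ‖ξ‖) S := contDiffOn_id.norm ℝ fun ξ hξ => (hS ξ hξ).1
  refine ContDiffOn.smul ?_ (hf.comp ?_ fun ξ hξ => (hS ξ hξ).2)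
  · refine (hnorm.div_const ρ).rpow_const_of_ne fun ξ hξ => ?_
    have := norm_pos_iff.2 (hS ξ hξ).1
    positivity
  · exact contDiffOn_const.smul ((hnorm.inv fun ξ hξ => norm_ne_zero_iff.2 (hS ξ hξ).1).smul
      contDiffOn_id)

theorem homogeneous_extension_smul {E F : Type*} [NormedAddCommGroup E] [NormedSpace ℝ E]
    [AddCommGroup F] [Module ℝ F] (f : E → F) {ρ : ℝ} (hρ : 0 < ρ) (s d : ℝ) (ξ : E) {t : ℝ}
    (ht : 0 < t) :
    ((‖t • ξ‖ / ρ) ^ d : ℝ) • f (s • ‖t • ξ‖⁻¹ • t • ξ) =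
      (t ^ d : ℝ) • ((‖ξ‖ / ρ) ^ d : ℝ) • f (s • ‖ξ‖⁻¹ • ξ) := by
  have h1 : ‖t • ξ‖ = t * ‖ξ‖ := by rw [norm_smul, Real.norm_of_nonneg ht.le]
  have h2 : ‖t • ξ‖⁻¹ • t • ξ = ‖ξ‖⁻¹ • ξ := by
    rw [h1, smul_smul, _root_.mul_inv_rev, mul_assoc, inv_mul_cancel₀ ht.ne', mul_one]
  rw [h2, h1, mul_div_assoc, Real.mul_rpow ht.le (by positivity), mul_smul]

/-- (Remark 3.6 b)). Let `a` be smooth and homogeneous of degree `d` on a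
truncated cone `S_{R,V}` over a nonempty (relatively) open subset `V` of the unit sphere.
Then on a smaller truncated cone `S_{R,Ṽ}` there exist a smooth eigenvalue `λ` and a smooth
nonvanishing eigenvector field `v`, both homogeneous of degree `d` on the cone. -/
theorem smooth_homogeneous_eigenpair_on_subcone (n N : ℕ) (hn : 1 ≤ n) (hN : 1 ≤ N)
    (R : ℝ) (hR : 0 < R) (d : ℝ)
    (V : Set (EuclideanSpace ℝ (Fin n))) (hVsub : V ⊆ Metric.sphere (0 : EuclideanSpace ℝ (Fin n)) 1)
    (hVopen : ∃ O : Set (EuclideanSpace ℝ (Fin n)), IsOpen O ∧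
      V = O ∩ Metric.sphere (0 : EuclideanSpace ℝ (Fin n)) 1)
    (hVne : V.Nonempty)
    (a : EuclideanSpace ℝ (Fin n) → Matrix (Fin N) (Fin N) ℂ)
    (ha : ∀ i j, ContDiffOn ℝ (⊤ : ℕ∞) (fun ξ => a ξ i j) (truncCone R V))
    (hhom : ∀ ξ ∈ truncCone R V, ∀ t : ℝ, 1 < t → a (t • ξ) = (t ^ d : ℝ) • a ξ) :
    ∃ Vt : Set (EuclideanSpace ℝ (Fin n)), Vt ⊆ V ∧ Vt.Nonempty ∧
      (∃ O : Set (EuclideanSpace ℝ (Fin n)), IsOpen O ∧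
        Vt = O ∩ Metric.sphere (0 : EuclideanSpace ℝ (Fin n)) 1) ∧
      ∃ lam : EuclideanSpace ℝ (Fin n) → ℂ,
        ∃ v : EuclideanSpace ℝ (Fin n) → Fin N → ℂ,
          ContDiffOn ℝ (⊤ : ℕ∞) lam (truncCone R Vt) ∧
          (∀ i, ContDiffOn ℝ (⊤ : ℕ∞) (fun ξ => v ξ i) (truncCone R Vt)) ∧
          ∀ ξ ∈ truncCone R Vt,
            v ξ ≠ 0 ∧ (a ξ).mulVec (v ξ) = lam ξ • v ξ ∧
            ∀ t : ℝ, 1 < t →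
              lam (t • ξ) = (t ^ d : ℝ) • lam ξ ∧ v (t • ξ) = (t ^ d : ℝ) • v ξ := by
  obtain ⟨O, hO, hVO⟩ := hVopen
  obtain ⟨η₀, hη₀⟩ := hVne
  have : Nonempty (Fin N) := ⟨⟨0, hN⟩⟩
  set ρ : ℝ := R + 1 with hρ_def
  have hRρ : R < ρ := by linarith
  have hρ : 0 < ρ := hR.trans hRρ
  have hunit : ∀ {x : EuclideanSpace ℝ (Fin n)}, x ≠ 0 → ‖‖x‖⁻¹ • x‖ = 1 := fun {x} hx => by
    rw [norm_smul, norm_inv, norm_norm, inv_mul_cancel₀ (norm_ne_zero_iff.2 hx)]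
  let Ω : Set (EuclideanSpace ℝ (Fin n)) := {0}ᶜ ∩ (fun x => ‖x‖⁻¹ • x) ⁻¹' O
  have hΩV : ∀ x ∈ Ω, ‖x‖⁻¹ • x ∈ V := fun x hx => by
    rw [hVO]
    exact ⟨hx.2, by simpa using hunit hx.1⟩
  have hΩo : IsOpen Ω := by
    refine ContinuousOn.isOpen_inter_preimage ?_ isOpen_compl_singleton hO
    exact (continuousOn_id.norm.inv₀ fun x hx => norm_ne_zero_iff.2 hx).smul continuousOn_id
  have hΩne : Ω.Nonempty := by
    have h1 : ‖η₀‖ = 1 := by simpa using hVsub hη₀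
    refine ⟨η₀, ?_, ?_⟩
    · rintro rfl
      simp at h1
    · rw [hVO] at hη₀
      simpa [h1] using hη₀.1
  obtain ⟨W, hWΩ, hWo, ⟨x₀, hx₀⟩, φ, v, hφ, hv, hpair⟩ :=
    exists_contDiffOn_eigenpair (A := fun x => a (ρ • ‖x‖⁻¹ • x)) hΩo hΩne fun i j => by
      simpa using contDiffOn_homogeneous_extension (ha i j) ρ ρ 0 hρ
        (fun x hx => ⟨hx.1, ρ, hRρ, _, hΩV x hx, rfl⟩)
  have hx₀0 : x₀ ≠ 0 := (hWΩ hx₀).1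
  set s : ℝ := ‖x₀‖ with hs_def
  have hs : 0 < s := norm_pos_iff.2 hx₀0
  let Vt : Set (EuclideanSpace ℝ (Fin n)) := (fun η => s • η) ⁻¹' W ∩ Metric.sphere 0 1
  have hnormalize : ∀ {η : EuclideanSpace ℝ (Fin n)}, η ∈ Metric.sphere 0 1 →
      ‖s • η‖⁻¹ • s • η = η := fun {η} hη => by
    rw [norm_smul, Real.norm_of_nonneg hs.le, mem_sphere_zero_iff_norm.1 hη, mul_one, smul_smul,
      inv_mul_cancel₀ hs.ne', one_smul]
  have hVtV : Vt ⊆ V := fun η hη => by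
    have := hΩV _ (hWΩ hη.1)
    rwa [hnormalize hη.2] at this
  have hcone : ∀ ξ ∈ truncCone R Vt, ξ ≠ 0 ∧ s • ‖ξ‖⁻¹ • ξ ∈ W := fun ξ hξ => by
    obtain ⟨h1, h2⟩ :=
      norm_pos_and_normalize_mem_of_mem_truncCone hR Set.inter_subset_right hξ
    exact ⟨norm_pos_iff.1 (hR.trans h1), h2.1⟩
  refine ⟨Vt, hVtV, ⟨s⁻¹ • x₀, ?_, ?_⟩, ⟨_, hWo.preimage (continuous_const_smul s), rfl⟩,
    fun ξ => ((‖ξ‖ / ρ) ^ d : ℝ) • φ (s • ‖ξ‖⁻¹ • ξ),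
    fun ξ => ((‖ξ‖ / ρ) ^ d : ℝ) • v (s • ‖ξ‖⁻¹ • ξ),
    contDiffOn_homogeneous_extension hφ ρ s d hρ hcone,
    fun i => contDiffOn_homogeneous_extension (hv i) ρ s d hρ hcone, fun ξ hξ => ⟨?_, ?_,
      fun t ht => ⟨homogeneous_extension_smul φ hρ s d ξ (by linarith),
        homogeneous_extension_smul v hρ s d ξ (by linarith)⟩⟩⟩
  · simpa [smul_smul, mul_inv_cancel₀ hs.ne'] using hx₀
  · simpa using hunit hx₀0
  · obtain ⟨hξ0, hξW⟩ := hcone ξ hξ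
    have : 0 < ‖ξ‖ := norm_pos_iff.2 hξ0
    exact smul_ne_zero (by positivity) (hpair _ hξW).1
  · obtain ⟨hRξ, hξV⟩ :=
      norm_pos_and_normalize_mem_of_mem_truncCone hR Set.inter_subset_right hξ
    obtain ⟨hξ0, hξW⟩ := hcone ξ hξ
    have hscale : a ξ = ((‖ξ‖ / ρ) ^ d : ℝ) • a (ρ • ‖ξ‖⁻¹ • ξ) := by
      rw [← eq_rpow_smul_of_homogeneous hR hhom (hVtV hξV) hRξ hRρ, smul_smul,
        mul_inv_cancel₀ (hR.trans hRξ).ne', one_smul]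
    have heig := (hpair _ hξW).2
    rw [hnormalize hξV.2] at heig
    rw [hscale, smul_mulVec, mulVec_smul, heig, smul_assoc, smul_comm (φ _)]

end
end

section
/- Let n ≥ 1, τ > 0, μ > 0, and for ξ ∈ ℝⁿ let ã₀(ξ) ∈ ℂ^{(n+3)×(n+3)} be the matrix with entries ã₀[1,2] = |ξ|; ã₀[2,1] = −|ξ|/μ; ã₀[2,3] = |ξ|/μ; ã₀[3,2] = −|ξ|; ã₀[3,3+k] = iξ_k for k = 1,…,n; ã₀[3+k,3] = iξ_k/τ for k = 1,…,n; and all other entries zero. Then for every ξ ∈ ℝⁿ and every λ ∈ ℂ, det(λ·I_{n+3} − ã₀(ξ)) = λ^{n−1}·(λ⁴ + (1/τ + 2/μ)|ξ|²λ² + (1/(τμ))|ξ|⁴). In particular, every eigenvalue of ã₀(ξ) is purely imaginary and depends only on |ξ|. -/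
open Matrix Complex

noncomputable section

/-- Row/column index type for the `(n+3) × (n+3)` system. -/
abbrev ThermoIdx (n : ℕ) := Fin 3 ⊕ Fin n

/-- The principal symbol `ã₀(ξ)` of the order-reduced thermoelastic plate system with
Cattaneo–Maxwell law (`τ > 0`) and inertial term (`μ > 0`):
`ã₀[1,2] = |ξ|`, `ã₀[2,1] = -|ξ|/μ`, `ã₀[2,3] = |ξ|/μ`, `ã₀[3,2] = -|ξ|`,
`ã₀[3,3+k] = i ξ_k`, `ã₀[3+k,3] = i ξ_k/τ`, all other entries `0`. -/
def thermoPrincipal (n : ℕ) (τ μ : ℝ) (ξ : EuclideanSpace ℝ (Fin n)) :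
    Matrix (ThermoIdx n) (ThermoIdx n) ℂ := fun i j =>
  match i, j with
  | Sum.inl ⟨0, _⟩, Sum.inl ⟨1, _⟩ => ((‖ξ‖ : ℝ) : ℂ)
  | Sum.inl ⟨1, _⟩, Sum.inl ⟨0, _⟩ => ((-(‖ξ‖) / μ : ℝ) : ℂ)
  | Sum.inl ⟨1, _⟩, Sum.inl ⟨2, _⟩ => ((‖ξ‖ / μ : ℝ) : ℂ)
  | Sum.inl ⟨2, _⟩, Sum.inl ⟨1, _⟩ => ((-(‖ξ‖) : ℝ) : ℂ)
  | Sum.inl ⟨2, _⟩, Sum.inr k => Complex.I * ((ξ k : ℝ) : ℂ)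
  | Sum.inr k, Sum.inl ⟨2, _⟩ => Complex.I * ((ξ k : ℝ) : ℂ) / (τ : ℂ)
  | _, _ => 0

theorem thermoPrincipal_eq_fromBlocks (n : ℕ) (τ μ : ℝ) (ξ : EuclideanSpace ℝ (Fin n)) (l : ℂ) :
    l • (1 : Matrix (ThermoIdx n) (ThermoIdx n) ℂ) - thermoPrincipal n τ μ ξ =
      fromBlocks !![l, -(‖ξ‖ : ℂ), 0; (‖ξ‖ : ℂ) / μ, l, -((‖ξ‖ : ℂ) / μ); 0, (‖ξ‖ : ℂ), l]
        (of fun i k => if i = 2 then -(I * (ξ k : ℂ)) else 0)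
        (of fun k j => if j = 2 then -(I * (ξ k : ℂ) / τ) else 0)
        (l • (1 : Matrix (Fin n) (Fin n) ℂ)) := by
  ext i j
  rcases i with i | i <;> rcases j with j | j
  · fin_cases i <;> fin_cases j <;> simp [thermoPrincipal, neg_div] <;> first | rfl | exact neg_neg _
  · fin_cases i <;> simp [thermoPrincipal]
    rfl
  · fin_cases j <;> simp [thermoPrincipal]
    rfl
  · simp [thermoPrincipal, one_apply]

theorem thermoPrincipal_det_of_ne_zero (n : ℕ) (hn : 1 ≤ n) (τ μ : ℝ) (hτ : 0 < τ) (hμ : 0 < μ)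
    (ξ : EuclideanSpace ℝ (Fin n)) {l : ℂ} (hl : l ≠ 0) :
    (l • (1 : Matrix (ThermoIdx n) (ThermoIdx n) ℂ) - thermoPrincipal n τ μ ξ).det =
      l ^ (n - 1) * (l ^ 4 + ((1 / τ + 2 / μ : ℝ) : ℂ) * ((‖ξ‖ ^ 2 : ℝ) : ℂ) * l ^ 2 +
        ((1 / (τ * μ) : ℝ) : ℂ) * ((‖ξ‖ ^ 4 : ℝ) : ℂ)) := by
  have hτ' : (τ : ℂ) ≠ 0 := by exact_mod_cast hτ.ne'
  have hμ' : (μ : ℂ) ≠ 0 := by exact_mod_cast hμ.ne'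
  have hs : ∑ k, (ξ k : ℂ) * (ξ k : ℂ) = (‖ξ‖ : ℂ) ^ 2 := by
    have h := EuclideanSpace.real_norm_sq_eq ξ
    rw [← ofReal_pow, h]
    push_cast
    simp only [sq]
  let _ : Invertible (l • (1 : Matrix (Fin n) (Fin n) ℂ)) :=
    ⟨l⁻¹ • 1, by simp [smul_smul, hl], by simp [smul_smul, hl]⟩
  have hinv : ⅟(l • (1 : Matrix (Fin n) (Fin n) ℂ)) = l⁻¹ • 1 := rfl
  have hschur : (of fun (i : Fin 3) k => if i = 2 then -(I * (ξ k : ℂ)) else 0) *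
      (l⁻¹ • (1 : Matrix (Fin n) (Fin n) ℂ)) *
      (of fun k (j : Fin 3) => if j = 2 then -(I * (ξ k : ℂ) / τ) else 0) =
      !![0, 0, 0; 0, 0, 0; 0, 0, -((‖ξ‖ : ℂ) ^ 2 / (τ * l))] := by
    ext i j
    fin_cases i <;> fin_cases j <;> simp [mul_apply]
    rw [← hs, Finset.sum_div, ← Finset.sum_neg_distrib]
    refine Finset.sum_congr rfl fun k _ => ?_
    field_simp
    rw [I_sq]
    ring
  rw [thermoPrincipal_eq_fromBlocks, det_fromBlocks₂₂, hinv, hschur, det_smul, det_one,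
    Fintype.card_fin, det_fin_three]
  obtain ⟨m, rfl⟩ := Nat.exists_eq_add_of_le' hn
  simp
  field_simp
  ring

theorem thermoPrincipal_det (n : ℕ) (hn : 1 ≤ n) (τ μ : ℝ) (hτ : 0 < τ) (hμ : 0 < μ)
    (ξ : EuclideanSpace ℝ (Fin n)) (l : ℂ) :
    (l • (1 : Matrix (ThermoIdx n) (ThermoIdx n) ℂ) - thermoPrincipal n τ μ ξ).det =
      l ^ (n - 1) * (l ^ 4 + ((1 / τ + 2 / μ : ℝ) : ℂ) * ((‖ξ‖ ^ 2 : ℝ) : ℂ) * l ^ 2 +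
        ((1 / (τ * μ) : ℝ) : ℂ) * ((‖ξ‖ ^ 4 : ℝ) : ℂ)) := by
  refine congrFun (Continuous.ext_on (dense_compl_singleton (0 : ℂ))
    (f := fun l : ℂ =>
      (l • (1 : Matrix (ThermoIdx n) (ThermoIdx n) ℂ) - thermoPrincipal n τ μ ξ).det)
    (g := fun l : ℂ => l ^ (n - 1) * (l ^ 4 + ((1 / τ + 2 / μ : ℝ) : ℂ) *
      ((‖ξ‖ ^ 2 : ℝ) : ℂ) * l ^ 2 + ((1 / (τ * μ) : ℝ) : ℂ) * ((‖ξ‖ ^ 4 : ℝ) : ℂ)))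
    (Continuous.matrix_det (by fun_prop)) (by fun_prop) fun l hl => ?_) l
  exact thermoPrincipal_det_of_ne_zero n hn τ μ hτ hμ ξ hl

/-- Roots of a biquadratic with nonnegative real coefficients and nonnegative discriminant are
purely imaginary. -/
theorem re_eq_zero_of_biquadratic_eq_zero {b c : ℝ} (hb : 0 ≤ b) (hc : 0 ≤ c)
    (hd : 4 * c ≤ b ^ 2) {l : ℂ} (h : l ^ 4 + (b : ℂ) * l ^ 2 + (c : ℂ) = 0) : l.re = 0 := by
  obtain ⟨x, y, hx⟩ : ∃ x y : ℝ, l ^ 2 = ⟨x, y⟩ := ⟨_, _, rfl⟩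
  have hq : (⟨x, y⟩ : ℂ) * ⟨x, y⟩ + b * ⟨x, y⟩ + c = 0 := by
    rw [← hx, ← h]
    ring
  have hre : x * x - y * y + b * x + c = 0 := by simpa using congrArg Complex.re hq
  have him : x * y + y * x + b * y = 0 := by simpa using congrArg Complex.im hq
  have hy : y = 0 := by
    by_contra hy
    have h2 : 2 * x + b = 0 := mul_right_cancel₀ hy (by linarith)
    have : 0 < y * y := mul_self_pos.2 hy
    obtain rfl : b = -2 * x := by linarith
    nlinarith
  subst hy
  have hx0 : x ≤ 0 := by
    by_contra! hx0
    nlinarith [mul_nonneg hb hx0.le, mul_pos hx0 hx0]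
  have h1 : l.re * l.re - l.im * l.im = x := by simpa [sq] using congrArg Complex.re hx
  have h2 : l.re * l.im + l.im * l.re = 0 := by simpa [sq] using congrArg Complex.im hx
  have h3 : l.re * l.im = 0 := by linarith
  rcases mul_eq_zero.1 h3 with h | h
  · exact h
  · rw [h] at h1
    exact mul_self_eq_zero.1 (le_antisymm (by linarith) (mul_self_nonneg _))

/-- char. polynomial computation in the proof of Theorem 4.3. For all
`ξ` and `λ`, `det(λ·I - ã₀(ξ)) = λ^{n-1}(λ⁴ + (1/τ + 2/μ)|ξ|²λ² + (1/(τμ))|ξ|⁴)`.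
In particular every eigenvalue of `ã₀(ξ)` is purely imaginary and depends only on `|ξ|`. -/
theorem thermoPrincipal_charpoly (n : ℕ) (hn : 1 ≤ n) (τ μ : ℝ) (hτ : 0 < τ) (hμ : 0 < μ) :
    (∀ (ξ : EuclideanSpace ℝ (Fin n)) (l : ℂ),
      (l • (1 : Matrix (ThermoIdx n) (ThermoIdx n) ℂ) - thermoPrincipal n τ μ ξ).det =
        l ^ (n - 1) * (l ^ 4 + ((1 / τ + 2 / μ : ℝ) : ℂ) * ((‖ξ‖ ^ 2 : ℝ) : ℂ) * l ^ 2 +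
          ((1 / (τ * μ) : ℝ) : ℂ) * ((‖ξ‖ ^ 4 : ℝ) : ℂ))) ∧
    (∀ (ξ : EuclideanSpace ℝ (Fin n)) (l : ℂ),
      (l • (1 : Matrix (ThermoIdx n) (ThermoIdx n) ℂ) - thermoPrincipal n τ μ ξ).det = 0 →
        l.re = 0) ∧
    (∀ (ξ η : EuclideanSpace ℝ (Fin n)), ‖ξ‖ = ‖η‖ → ∀ l : ℂ,
      ((l • (1 : Matrix (ThermoIdx n) (ThermoIdx n) ℂ) - thermoPrincipal n τ μ ξ).det = 0 ↔
       (l • (1 : Matrix (ThermoIdx n) (ThermoIdx n) ℂ) - thermoPrincipal n τ μ η).det = 0)) := by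
  have hdet := thermoPrincipal_det n hn τ μ hτ hμ
  refine ⟨hdet, fun ξ l h => ?_, fun ξ η hξη l => by rw [hdet, hdet, hξη]⟩
  rw [hdet, mul_eq_zero] at h
  rcases h with h | h
  · rw [eq_zero_of_pow_eq_zero h, zero_re]
  · rw [← ofReal_mul, ← ofReal_mul] at h
    refine re_eq_zero_of_biquadratic_eq_zero (by positivity) (by positivity) ?_ h
    have key : ((1 / τ + 2 / μ) * ‖ξ‖ ^ 2) ^ 2 - 4 * (1 / (τ * μ) * ‖ξ‖ ^ 4) =
        ((1 / τ) ^ 2 + (2 / μ) ^ 2) * ‖ξ‖ ^ 4 := by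
      field_simp
      ring
    have : 0 ≤ ((1 / τ) ^ 2 + (2 / μ) ^ 2) * ‖ξ‖ ^ 4 := by positivity
    linarith

end
end

section
/- Let μ > 0 and τ > 0, and define the 4×4 complex matrices a_± with entries a_±[1,2] = ±1; a_±[2,1] = ∓1/μ; a_±[2,3] = ±1/μ; a_±[3,2] = ∓1; a_±[3,4] = i; a_±[4,3] = i/τ; all other entries zero. Then each of a_+ and a_− has four pairwise distinct eigenvalues, all of which are purely imaginary and nonzero; in particular a_+ and a_− are diagonalizable. Equivalently, the polynomial z⁴ + (1/τ + 2/μ)z² + 1/(τμ) has four pairwise distinct roots, all purely imaginary and nonzero. -/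
open Matrix Complex

noncomputable section

/-- The matrix `a₊` (the `n = 1` principal symbol of the order-reduced thermoelastic plate
system with Cattaneo–Maxwell law for `ξ ≥ 0`). -/
def aPlus (μ τ : ℝ) : Matrix (Fin 4) (Fin 4) ℂ :=
  !![0, 1, 0, 0;
     -1 / (μ : ℂ), 0, 1 / (μ : ℂ), 0;
     0, -1, 0, Complex.I;
     0, 0, Complex.I / (τ : ℂ), 0]

/-- The matrix `a₋` (the `n = 1` principal symbol for `ξ < 0`). -/
def aMinus (μ τ : ℝ) : Matrix (Fin 4) (Fin 4) ℂ :=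
  !![0, -1, 0, 0;
     1 / (μ : ℂ), 0, -1 / (μ : ℂ), 0;
     0, 1, 0, Complex.I;
     0, 0, Complex.I / (τ : ℂ), 0]

/-- A square matrix over a field with pairwise distinct eigenvalues `z j`, as many as its size,
is diagonalizable. -/
theorem exists_eq_mul_diagonal_mul_inv {K ι : Type*} [Field K] [Fintype ι] [DecidableEq ι]
    (A : Matrix ι ι K) (z : ι → K) (hz : Function.Injective z)
    (h : ∀ j, (z j • (1 : Matrix ι ι K) - A).det = 0) :
    ∃ P : Matrix ι ι K, IsUnit P ∧ A = P * Matrix.diagonal z * P⁻¹ := by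
  have hv : ∀ j, ∃ v : ι → K, v ≠ 0 ∧ A *ᵥ v = z j • v := by
    intro j
    obtain ⟨v, hv0, hv⟩ := Matrix.exists_mulVec_eq_zero_iff.2 (h j)
    rw [Matrix.sub_mulVec, Matrix.smul_mulVec, Matrix.one_mulVec, sub_eq_zero] at hv
    exact ⟨v, hv0, hv.symm⟩
  choose v hv0 hv using hv
  have hlin : LinearIndependent K v :=
    Module.End.eigenvectors_linearIndependent' (Matrix.toLin' A) z hz v fun j =>
      ⟨Module.End.mem_eigenspace_iff.2 (by rw [Matrix.toLin'_apply, hv]), hv0 j⟩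
  let P : Matrix ι ι K := Matrix.of fun i j => v j i
  have hP : IsUnit P := Matrix.linearIndependent_cols_iff_isUnit.1 hlin
  have hAP : A * P = P * Matrix.diagonal z := by
    ext i j
    rw [Matrix.mul_diagonal]
    simpa [P, Matrix.mul_apply, Matrix.mulVec, dotProduct, mul_comm] using congrFun (hv j) i
  refine ⟨P, hP, ?_⟩
  rw [← hAP, Matrix.mul_assoc, Matrix.mul_nonsing_inv _ ((Matrix.isUnit_iff_isUnit_det P).1 hP),
    Matrix.mul_one]

/-- The biquadratic `x ^ 4 - s * x ^ 2 + p` with positive coefficients and positive discriminant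
has two distinct positive roots. -/
theorem exists_sq_add_sq_eq_and_sq_mul_sq_eq {s p : ℝ} (hs : 0 < s) (hp : 0 < p)
    (hd : 0 < s ^ 2 - 4 * p) :
    ∃ α β : ℝ, 0 < β ∧ β < α ∧ α ^ 2 + β ^ 2 = s ∧ α ^ 2 * β ^ 2 = p := by
  have hd0 := Real.sqrt_pos.2 hd
  have hd2 := Real.sq_sqrt hd.le
  set d := √(s ^ 2 - 4 * p)
  have hds : d < s := by nlinarith
  have hA := Real.sq_sqrt (show 0 ≤ (s + d) / 2 by linarith)
  have hB := Real.sq_sqrt (show 0 ≤ (s - d) / 2 by linarith)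
  refine ⟨√((s + d) / 2), √((s - d) / 2), Real.sqrt_pos.2 (by linarith),
    Real.sqrt_lt_sqrt (by linarith) (by linarith), ?_, ?_⟩
  · rw [hA, hB]; ring
  · rw [hA, hB]; linarith

theorem det_smul_one_sub_aPlus (μ τ : ℝ) (l : ℂ) :
    (l • (1 : Matrix (Fin 4) (Fin 4) ℂ) - aPlus μ τ).det =
      l ^ 4 + ((1 / τ + 2 / μ : ℝ) : ℂ) * l ^ 2 + ((1 / (τ * μ) : ℝ) : ℂ) := by
  simp [aPlus, Matrix.det_succ_row_zero, Fin.sum_univ_succ, Fin.succAbove, Matrix.one_apply]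
  ring_nf
  simp only [Complex.I_sq]
  ring

theorem det_smul_one_sub_aMinus (μ τ : ℝ) (l : ℂ) :
    (l • (1 : Matrix (Fin 4) (Fin 4) ℂ) - aMinus μ τ).det =
      l ^ 4 + ((1 / τ + 2 / μ : ℝ) : ℂ) * l ^ 2 + ((1 / (τ * μ) : ℝ) : ℂ) := by
  simp [aMinus, Matrix.det_succ_row_zero, Fin.sum_univ_succ, Fin.succAbove, Matrix.one_apply]
  ring_nf
  simp only [Complex.I_sq]
  ring

/-- spectral fact in the proof of Theorem 4.3. For `μ, τ > 0`, the
matrices `a₊` and `a₋` have four pairwise distinct, purely imaginary, nonzero eigenvalues;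
in particular they are diagonalizable. Equivalently, `z⁴ + (1/τ + 2/μ)z² + 1/(τμ)` has four
pairwise distinct, purely imaginary, nonzero roots. -/
theorem aPlusMinus_distinct_imaginary_eigenvalues (μ τ : ℝ) (hμ : 0 < μ) (hτ : 0 < τ) :
    ∃ z : Fin 4 → ℂ, Function.Injective z ∧
      (∀ j, (z j).re = 0 ∧ z j ≠ 0) ∧
      (∀ l : ℂ, (l • (1 : Matrix (Fin 4) (Fin 4) ℂ) - aPlus μ τ).det =
        ∏ j : Fin 4, (l - z j)) ∧
      (∀ l : ℂ, (l • (1 : Matrix (Fin 4) (Fin 4) ℂ) - aMinus μ τ).det =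
        ∏ j : Fin 4, (l - z j)) ∧
      (∀ l : ℂ, l ^ 4 + ((1 / τ + 2 / μ : ℝ) : ℂ) * l ^ 2 + ((1 / (τ * μ) : ℝ) : ℂ) =
        ∏ j : Fin 4, (l - z j)) ∧
      (∃ P : Matrix (Fin 4) (Fin 4) ℂ, IsUnit P ∧
        aPlus μ τ = P * Matrix.diagonal z * P⁻¹) ∧
      (∃ Q : Matrix (Fin 4) (Fin 4) ℂ, IsUnit Q ∧
        aMinus μ τ = Q * Matrix.diagonal z * Q⁻¹) := by
  obtain ⟨α, β, hβ, hαβ, hsum, hprod⟩ := exists_sq_add_sq_eq_and_sq_mul_sq_eq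
    (s := 1 / τ + 2 / μ) (p := 1 / (τ * μ)) (by positivity) (by positivity) (by
      have : (1 / τ + 2 / μ) ^ 2 - 4 * (1 / (τ * μ)) = (1 / τ) ^ 2 + (2 / μ) ^ 2 := by
        field_simp
        ring
      rw [this]
      positivity)
  let y : Fin 4 → ℝ := ![α, -α, β, -β]
  let z : Fin 4 → ℂ := fun j => (y j : ℂ) * Complex.I
  have hy : Function.Injective y := by
    intro i j hij
    fin_cases i <;> fin_cases j <;> simp [y] at hij ⊢ <;> linarith
  have hz : Function.Injective z := fun i j hij =>
    hy (Complex.ofReal_injective (mul_right_cancel₀ Complex.I_ne_zero hij))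
  have hy0 : ∀ j, y j ≠ 0 := by
    intro j
    fin_cases j <;> simp [y] <;> linarith
  have hpoly : ∀ l : ℂ, l ^ 4 + ((1 / τ + 2 / μ : ℝ) : ℂ) * l ^ 2 + ((1 / (τ * μ) : ℝ) : ℂ) =
      ∏ j : Fin 4, (l - z j) := by
    intro l
    rw [← hsum, ← hprod]
    simp only [Fin.prod_univ_four, z, y, Matrix.cons_val]
    push_cast
    linear_combination (l ^ 2 * (α ^ 2 + β ^ 2) + α ^ 2 * β ^ 2 * (1 - Complex.I ^ 2)) *
      Complex.I_sq
  have hplus := fun l => (det_smul_one_sub_aPlus μ τ l).trans (hpoly l)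
  have hminus := fun l => (det_smul_one_sub_aMinus μ τ l).trans (hpoly l)
  have hroot : ∀ i, ∏ j, (z i - z j) = 0 := fun i =>
    Finset.prod_eq_zero (Finset.mem_univ i) (sub_self _)
  exact ⟨z, hz, fun j => ⟨by simp [z], by simpa [z] using hy0 j⟩, hplus, hminus, hpoly,
    exists_eq_mul_diagonal_mul_inv _ z hz fun j => (hplus _).trans (hroot j),
    exists_eq_mul_diagonal_mul_inv _ z hz fun j => (hminus _).trans (hroot j)⟩

end
end

section
/- Let n ≥ 1 and for ξ ∈ ℝⁿ let ã₀(ξ) ∈ ℂ^{(n+3)×(n+3)} be the matrix with entries ã₀[1,2] = |ξ|²; ã₀[2,1] = −|ξ|²; ã₀[2,3] = |ξ|²; ã₀[3,2] = −|ξ|²; and all other entries zero. Then for every ξ ∈ ℝⁿ and every λ ∈ ℂ, det(λ·I_{n+3} − ã₀(ξ)) = λ^{n+1}·(λ² + 2|ξ|⁴). In particular, the nonzero eigenvalues of ã₀(ξ) are ±i√2·|ξ|², which are purely imaginary. -/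
open Matrix Complex

noncomputable section

/-- The principal symbol `ã₀(ξ)` of the order-reduced thermoelastic plate system with
Cattaneo–Maxwell law (`τ > 0`) and without inertial term (`μ = 0`):
`ã₀[1,2] = |ξ|²`, `ã₀[2,1] = -|ξ|²`, `ã₀[2,3] = |ξ|²`, `ã₀[3,2] = -|ξ|²`, all other
entries `0`. -/
def thermoPrincipalNoInertia (n : ℕ) (ξ : EuclideanSpace ℝ (Fin n)) :
    Matrix (ThermoIdx n) (ThermoIdx n) ℂ := fun i j =>
  match i, j with
  | Sum.inl ⟨0, _⟩, Sum.inl ⟨1, _⟩ => ((‖ξ‖ ^ 2 : ℝ) : ℂ)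
  | Sum.inl ⟨1, _⟩, Sum.inl ⟨0, _⟩ => ((-(‖ξ‖ ^ 2) : ℝ) : ℂ)
  | Sum.inl ⟨1, _⟩, Sum.inl ⟨2, _⟩ => ((‖ξ‖ ^ 2 : ℝ) : ℂ)
  | Sum.inl ⟨2, _⟩, Sum.inl ⟨1, _⟩ => ((-(‖ξ‖ ^ 2) : ℝ) : ℂ)
  | _, _ => 0

theorem thermoPrincipalNoInertia_eq_fromBlocks (n : ℕ) (ξ : EuclideanSpace ℝ (Fin n)) :
    thermoPrincipalNoInertia n ξ =
      fromBlocks !![0, ((‖ξ‖ ^ 2 : ℝ) : ℂ), 0;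
        ((-(‖ξ‖ ^ 2) : ℝ) : ℂ), 0, ((‖ξ‖ ^ 2 : ℝ) : ℂ);
        0, ((-(‖ξ‖ ^ 2) : ℝ) : ℂ), 0] 0 0 0 := by
  ext (i | i) (j | j)
  · fin_cases i <;> fin_cases j <;> rfl
  all_goals simp [thermoPrincipalNoInertia]

theorem det_smul_one_sub_thermoPrincipalNoInertia (n : ℕ) (ξ : EuclideanSpace ℝ (Fin n))
    (l : ℂ) :
    (l • (1 : Matrix (ThermoIdx n) (ThermoIdx n) ℂ) - thermoPrincipalNoInertia n ξ).det =
      l ^ (n + 1) * (l ^ 2 + 2 * ((‖ξ‖ ^ 4 : ℝ) : ℂ)) := by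
  rw [thermoPrincipalNoInertia_eq_fromBlocks, ← fromBlocks_one, fromBlocks_smul,
    sub_eq_add_neg, fromBlocks_neg, fromBlocks_add]
  simp only [smul_zero, neg_zero, add_zero]
  rw [det_fromBlocks_zero₂₁, det_fin_three]
  simp [one_apply]
  ring

/-- (spectral computation in the proof of Theorem 4.4 b)). For all `ξ`
and `λ`, `det(λ·I - ã₀(ξ)) = λ^{n+1}(λ² + 2|ξ|⁴)`; in particular, the nonzero eigenvalues
of `ã₀(ξ)` are `±i√2·|ξ|²`, which are purely imaginary. -/
theorem thermoPrincipalNoInertia_charpoly (n : ℕ) (hn : 1 ≤ n) :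
    (∀ (ξ : EuclideanSpace ℝ (Fin n)) (l : ℂ),
      (l • (1 : Matrix (ThermoIdx n) (ThermoIdx n) ℂ) - thermoPrincipalNoInertia n ξ).det =
        l ^ (n + 1) * (l ^ 2 + 2 * ((‖ξ‖ ^ 4 : ℝ) : ℂ))) ∧
    (∀ (ξ : EuclideanSpace ℝ (Fin n)) (l : ℂ),
      (l • (1 : Matrix (ThermoIdx n) (ThermoIdx n) ℂ) - thermoPrincipalNoInertia n ξ).det = 0 →
        l = 0 ∨ l = Complex.I * ((Real.sqrt 2 * ‖ξ‖ ^ 2 : ℝ) : ℂ) ∨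
          l = -(Complex.I * ((Real.sqrt 2 * ‖ξ‖ ^ 2 : ℝ) : ℂ))) := by
  refine ⟨det_smul_one_sub_thermoPrincipalNoInertia n, fun ξ l h => ?_⟩
  rw [det_smul_one_sub_thermoPrincipalNoInertia, mul_eq_zero] at h
  refine h.imp eq_zero_of_pow_eq_zero fun h => ?_
  rw [← sq_eq_sq_iff_eq_or_eq_neg]
  have sqrt_two_sq : ((Real.sqrt 2 : ℝ) : ℂ) ^ 2 = 2 := by
    norm_cast
    exact Real.sq_sqrt zero_le_two
  push_cast at h ⊢
  rw [mul_pow, mul_pow, I_sq, sqrt_two_sq]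
  linear_combination h

end
end

section
/- Let μ > 0 and τ > 0, and define the 4×4 complex matrix b₀ with entries b₀[1,2] = 1; b₀[2,1] = −1/μ; b₀[2,3] = 1/μ; b₀[3,2] = −1; b₀[3,4] = i; b₀[4,3] = i/τ; all other entries zero. Then there exists λ₀ > 0 such that the matrix b₀ − λ₀·I₄ is invertible and every one of the sixteen entries of (b₀ − λ₀·I₄)⁻¹ is nonzero. -/
open Matrix Complex

noncomputable section

/-- The leading `4 × 4` block `b₀` of the thermoelastic plate symbol with Cattaneo–Maxwell
law (`τ > 0`) and inertial term (`μ > 0`) along the direction `ξ = (ρ,0,…,0)`. -/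
def bZero (μ τ : ℝ) : Matrix (Fin 4) (Fin 4) ℂ :=
  !![0, 1, 0, 0;
     -1 / (μ : ℂ), 0, 1 / (μ : ℂ), 0;
     0, -1, 0, Complex.I;
     0, 0, Complex.I / (τ : ℂ), 0]

/-- The adjugate of `b₀ - I₄`, written with `a = 1/μ` and `t = 1/τ`. -/
def bZeroSubOneAdjugate (a t : ℂ) : Matrix (Fin 4) (Fin 4) ℂ :=
  !![-(1 + t + a), -(1 + t), -a, -(a * I);
     a * (1 + t), -(1 + t), -a, -(a * I);
     -a, 1, -(1 + a), -(I * (1 + a));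
     -(a * I * t), I * t, -(I * t * (1 + a)), -(1 + 2 * a)]

theorem bZero_sub_one_mul_adjugate (μ τ : ℝ) :
    (bZero μ τ - 1) * bZeroSubOneAdjugate (μ : ℂ)⁻¹ (τ : ℂ)⁻¹ =
      (1 + 2 * (μ : ℂ)⁻¹ + (τ : ℂ)⁻¹ * (1 + (μ : ℂ)⁻¹)) • 1 := by
  ext i j
  fin_cases i <;> fin_cases j <;>
    simp [bZero, bZeroSubOneAdjugate, Matrix.mul_apply, Fin.sum_univ_four, Matrix.one_apply,
      div_eq_mul_inv] <;>
    ring_nf <;> simp [I_sq]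

theorem bZeroSubOneAdjugate_apply_ne_zero {a t : ℝ} (ha : 0 < a) (ht : 0 < t) (i j : Fin 4) :
    bZeroSubOneAdjugate a t i j ≠ 0 := by
  have ha0 : (a : ℂ) ≠ 0 := by exact_mod_cast ha.ne'
  have ht0 : (t : ℂ) ≠ 0 := by exact_mod_cast ht.ne'
  have ha1 : (1 + a : ℂ) ≠ 0 := by exact_mod_cast (by positivity : 1 + a ≠ 0)
  have ht1 : (1 + t : ℂ) ≠ 0 := by exact_mod_cast (by positivity : 1 + t ≠ 0)
  have ha2 : (1 + 2 * a : ℂ) ≠ 0 := by exact_mod_cast (by positivity : 1 + 2 * a ≠ 0)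
  have hta : (1 + t + a : ℂ) ≠ 0 := by exact_mod_cast (by positivity : 1 + t + a ≠ 0)
  fin_cases i <;> fin_cases j <;>
    simp only [bZeroSubOneAdjugate, Fin.zero_eta, Fin.mk_one, Fin.reduceFinMk, of_apply,
      cons_val', cons_val, cons_val_zero, cons_val_one, ne_eq, neg_eq_zero, mul_eq_zero, I_ne_zero,
      one_ne_zero, ha0, ht0, ha1, ht1, ha2, hta, or_self, not_false_eq_true]

/-- (matrix computation in the proof of Lemma 4.1 b)). For `μ, τ > 0`
there is `λ₀ > 0` such that `b₀ - λ₀·I₄` is invertible and all sixteen entries of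
`(b₀ - λ₀·I₄)⁻¹` are nonzero. -/
theorem bZero_resolvent_entries_nonzero (μ τ : ℝ) (hμ : 0 < μ) (hτ : 0 < τ) :
    ∃ lam₀ : ℝ, 0 < lam₀ ∧
      IsUnit (bZero μ τ - (lam₀ : ℂ) • (1 : Matrix (Fin 4) (Fin 4) ℂ)) ∧
      ∀ i j : Fin 4, (bZero μ τ - (lam₀ : ℂ) • (1 : Matrix (Fin 4) (Fin 4) ℂ))⁻¹ i j ≠ 0 := by
  obtain ⟨hD, hN⟩ : (1 + 2 * (μ : ℂ)⁻¹ + (τ : ℂ)⁻¹ * (1 + (μ : ℂ)⁻¹)) ≠ 0 ∧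
      ∀ i j, bZeroSubOneAdjugate (μ : ℂ)⁻¹ (τ : ℂ)⁻¹ i j ≠ 0 := by
    refine ⟨?_, fun i j => ?_⟩
    · exact_mod_cast (by positivity : 1 + 2 * μ⁻¹ + τ⁻¹ * (1 + μ⁻¹) ≠ 0)
    · simpa using bZeroSubOneAdjugate_apply_ne_zero (inv_pos.2 hμ) (inv_pos.2 hτ) i j
  have h : (bZero μ τ - 1) * ((1 + 2 * (μ : ℂ)⁻¹ + (τ : ℂ)⁻¹ * (1 + (μ : ℂ)⁻¹))⁻¹ •
      bZeroSubOneAdjugate (μ : ℂ)⁻¹ (τ : ℂ)⁻¹) = 1 := by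
    rw [mul_smul_comm, bZero_sub_one_mul_adjugate, inv_smul_smul₀ hD]
  refine ⟨1, one_pos, ?_⟩
  rw [ofReal_one, one_smul, inv_eq_right_inv h]
  exact ⟨IsUnit.of_mul_eq_one _ h, fun i j => mul_ne_zero (inv_ne_zero hD) (hN i j)⟩

end
end
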